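/- arXiv:1605.05626 — 9 statements merged into one kernel-verified Lean document; each statement's English description precedes it below -/
import Mathlib

section
/- Let n ≥ 1 and let W be a ℂ-linear subspace of the space of n×n complex matrices that contains all diagonal matrices. Suppose there exists a positive integer r and a nonzero polynomial P in the n² matrix entries such that every n×n complex matrix A with P(A) ≠ 0 can be written as a product of r elements of W. Then every n×n complex matrix is a product of 4r+1 elements of W. -/
section SetPow

open scoped Pointwise

theorem Submodule.smul_mem_coe_pow {R M : Type*} [CommSemiring R] [Semiring M] [Algebra R M]
    (W : Submodule R M) {r : ℕ} (hr : 0 < r) (c : R) {a : M}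
    (ha : a ∈ (W : Set M) ^ r) : c • a ∈ (W : Set M) ^ r := by
  obtain ⟨k, rfl⟩ := Nat.exists_eq_succ_of_ne_zero hr.ne'
  rw [Nat.succ_eq_add_one, pow_succ'] at ha ⊢
  obtain ⟨x, hx, y, hy, rfl⟩ := ha
  exact ⟨c • x, W.smul_mem c hx, y, hy, smul_mul_assoc c x y⟩

end SetPow

theorem MvPolynomial.exists_eval_ne_zero {σ K : Type*} [Field K] [Infinite K]
    {p : MvPolynomial σ K} (hp : p ≠ 0) : ∃ x : σ → K, MvPolynomial.eval x p ≠ 0 := by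
  by_contra! h
  exact hp (MvPolynomial.funext fun x => by simpa using h x)

namespace Matrix

variable {m : Type*} [Fintype m] [DecidableEq m] {K : Type*} [Field K]

/-- Precomposition of a polynomial in the matrix entries with `X ↦ t • (adjugate X * A)`. -/
theorem exists_eval_eq_eval_smul_adjugate_mul (P : MvPolynomial (m × m) K) (t : K)
    (A : Matrix m m K) :
    ∃ Q : MvPolynomial (m × m) K, ∀ x : m × m → K, MvPolynomial.eval x Q =
      MvPolynomial.eval
        (fun p => (t • (adjugate (Matrix.of fun i j => x (i, j)) * A)) p.1 p.2) P := by
  refine ⟨MvPolynomial.bind₁ (fun p => MvPolynomial.C t *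
    (adjugate (mvPolynomialX m m K) * A.map MvPolynomial.C : Matrix m m _) p.1 p.2) P, fun x => ?_⟩
  have hadj : ∀ i j, MvPolynomial.eval x (adjugate (mvPolynomialX m m K) i j) =
      adjugate (Matrix.of fun i j => x (i, j)) i j := by
    intro i j
    have h := RingHom.map_adjugate (MvPolynomial.eval x) (mvPolynomialX m m K)
    have hX : (MvPolynomial.eval x).mapMatrix (mvPolynomialX m m K) =
        Matrix.of fun i j => x (i, j) := by
      ext i j
      simp [mvPolynomialX]
    rw [hX] at h
    simpa using congrFun (congrFun h i) j
  rw [← MvPolynomial.coe_aeval_eq_eval, RingHom.coe_coe, MvPolynomial.aeval_bind₁,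
    ← MvPolynomial.coe_aeval_eq_eval, RingHom.coe_coe]
  congr 2
  ext p
  simp [mul_apply, MvPolynomial.aeval_eq_eval, hadj]

/-- Every invertible matrix factors as `X * Y` with `X` and a nonzero multiple of `Y` outside the
zero locus of a given nonzero polynomial. -/
theorem exists_mul_smul_eq_of_det_ne_zero [Infinite K] {P : MvPolynomial (m × m) K} (hP : P ≠ 0)
    {A : Matrix m m K} (hA : A.det ≠ 0) :
    ∃ (X Y : Matrix m m K) (c : K), MvPolynomial.eval (fun p => X p.1 p.2) P ≠ 0 ∧
      MvPolynomial.eval (fun p => Y p.1 p.2) P ≠ 0 ∧ A = X * (c • Y) := by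
  have hdet := det_mvPolynomialX_ne_zero m K
  obtain ⟨b, hb⟩ := MvPolynomial.exists_eval_ne_zero (mul_ne_zero hP hdet)
  rw [map_mul, eval_det_mvPolynomialX] at hb
  obtain ⟨hPb, hb⟩ := mul_ne_zero_iff.mp hb
  set B : Matrix m m K := Matrix.of fun i j => b (i, j)
  set X₀ := A * B⁻¹
  have hX₀ : X₀.det ≠ 0 := by
    rw [det_mul, det_nonsing_inv, Ring.inverse_eq_inv']
    exact mul_ne_zero hA (inv_ne_zero hb)
  obtain ⟨Q, hQ⟩ := exists_eval_eq_eval_smul_adjugate_mul P X₀.det⁻¹ A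
  have hQ₀ : Q ≠ 0 := by
    rintro rfl
    have h := hQ fun p => X₀ p.1 p.2
    have hB : X₀.det⁻¹ • (adjugate (Matrix.of fun i j => X₀ i j) * A) = B := by
      have hA' : A = X₀ * B := (nonsing_inv_mul_cancel_right _ _ (isUnit_iff_ne_zero.mpr hb)).symm
      change X₀.det⁻¹ • (adjugate X₀ * A) = B
      conv_lhs => rw [hA', ← Matrix.mul_assoc, adjugate_mul, smul_mul, Matrix.one_mul]
      rw [smul_smul, inv_mul_cancel₀ hX₀, one_smul]
    rw [hB, map_zero] at h
    exact hPb h.symm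
  obtain ⟨x, hx⟩ := MvPolynomial.exists_eval_ne_zero (mul_ne_zero (mul_ne_zero hP hdet) hQ₀)
  rw [map_mul, map_mul, eval_det_mvPolynomialX, hQ] at hx
  obtain ⟨hx, hQx⟩ := mul_ne_zero_iff.mp hx
  obtain ⟨hPx, hx⟩ := mul_ne_zero_iff.mp hx
  refine ⟨Matrix.of fun i j => x (i, j), _, X₀.det * (det (Matrix.of fun i j => x (i, j)))⁻¹,
    hPx, hQx, ?_⟩
  rw [smul_smul, Matrix.mul_smul, ← Matrix.mul_assoc, mul_adjugate, smul_mul, Matrix.one_mul,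
    smul_smul]
  field_simp
  simp

/-- Every matrix is a diagonal matrix multiplied on both sides by invertible matrices. -/
theorem exists_eq_mul_diagonal_mul (A : Matrix m m K) :
    ∃ (U V : Matrix m m K) (d : m → K), U.det ≠ 0 ∧ V.det ≠ 0 ∧ A = U * diagonal d * V := by
  obtain ⟨L, L', d, h⟩ := Pivot.exists_list_transvec_mul_diagonal_mul_list_transvec A
  exact ⟨_, _, d, by simp [TransvectionStruct.det_toMatrix_prod],
    by simp [TransvectionStruct.det_toMatrix_prod], h⟩

end Matrix

/-- If `W` is a linear subspace of `n×n` complex matrices containing all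
diagonal matrices, and there is a nonzero polynomial `P` in the matrix entries such that
every matrix `A` with `P(A) ≠ 0` is a product of `r` elements of `W`, then every matrix is
a product of `4r+1` elements of `W`. -/
theorem stmt0 (n : ℕ) (hn : 1 ≤ n) (W : Submodule ℂ (Matrix (Fin n) (Fin n) ℂ))
    (hdiag : ∀ d : Fin n → ℂ, Matrix.diagonal d ∈ W)
    (r : ℕ) (hr : 0 < r)
    (P : MvPolynomial (Fin n × Fin n) ℂ) (hP : P ≠ 0)
    (hgen : ∀ A : Matrix (Fin n) (Fin n) ℂ,
      MvPolynomial.eval (fun p => A p.1 p.2) P ≠ 0 →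
      ∃ f : Fin r → Matrix (Fin n) (Fin n) ℂ,
        (∀ i, f i ∈ W) ∧ A = (List.ofFn f).prod) :
    ∀ A : Matrix (Fin n) (Fin n) ℂ,
      ∃ f : Fin (4 * r + 1) → Matrix (Fin n) (Fin n) ℂ,
        (∀ i, f i ∈ W) ∧ A = (List.ofFn f).prod := by
  open scoped Pointwise in
  have hgen' : ∀ A : Matrix (Fin n) (Fin n) ℂ, MvPolynomial.eval (fun p => A p.1 p.2) P ≠ 0 →
      A ∈ (W : Set (Matrix (Fin n) (Fin n) ℂ)) ^ r := by
    intro A hA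
    obtain ⟨f, hf, rfl⟩ := hgen A hA
    exact Set.mem_pow.mpr ⟨fun i => ⟨f i, hf i⟩, rfl⟩
  open scoped Pointwise in
  have hinv : ∀ A : Matrix (Fin n) (Fin n) ℂ, A.det ≠ 0 →
      A ∈ (W : Set (Matrix (Fin n) (Fin n) ℂ)) ^ (r + r) := by
    intro A hA
    obtain ⟨X, Y, c, hX, hY, rfl⟩ := Matrix.exists_mul_smul_eq_of_det_ne_zero hP hA
    rw [pow_add]
    exact Set.mul_mem_mul (hgen' X hX) (W.smul_mem_coe_pow hr c (hgen' Y hY))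
  open scoped Pointwise in
  have hall : ∀ A : Matrix (Fin n) (Fin n) ℂ,
      A ∈ (W : Set (Matrix (Fin n) (Fin n) ℂ)) ^ (4 * r + 1) := by
    intro A
    obtain ⟨U, V, d, hU, hV, rfl⟩ := A.exists_eq_mul_diagonal_mul
    rw [show 4 * r + 1 = r + r + 1 + (r + r) by ring, pow_add, pow_succ]
    exact Set.mul_mem_mul (Set.mul_mem_mul (hinv U hU) (hdiag d)) (hinv V hV)
  intro A
  obtain ⟨f, hf⟩ := Set.mem_pow.mp (hall A)
  exact ⟨fun i => f i, fun i => (f i).2, hf.symm⟩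
end

section
/- Every n×n complex matrix A can be written as A = L₁U₁L₂U₂L₃U₃L₄U₄, where L₁, L₂, L₃, L₄ are lower triangular matrices and U₁, U₂, U₃, U₄ are upper triangular matrices. -/
/-- The matrix with corner entry `a`, remaining first row `b`, remaining first column `c` and
lower right block `D`. -/
def borderedMatrix {K : Type*} {n : ℕ} (a : K) (b c : Fin n → K) (D : Matrix (Fin n) (Fin n) K) :
    Matrix (Fin (n + 1)) (Fin (n + 1)) K :=
  fun i j => Fin.cases (Fin.cases a b j) (fun i' => Fin.cases (c i') (D i') j) i

section

variable {K : Type*} {n : ℕ} (a : K) (b c : Fin n → K) (D : Matrix (Fin n) (Fin n) K)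

@[simp] theorem borderedMatrix_zero_zero : borderedMatrix a b c D 0 0 = a := rfl

@[simp] theorem borderedMatrix_zero_succ (j : Fin n) :
    borderedMatrix a b c D 0 j.succ = b j := rfl

@[simp] theorem borderedMatrix_succ_zero (i : Fin n) :
    borderedMatrix a b c D i.succ 0 = c i := rfl

@[simp] theorem borderedMatrix_succ_succ (i j : Fin n) :
    borderedMatrix a b c D i.succ j.succ = D i j := rfl

end

theorem borderedMatrix_upper {K : Type*} [Zero K] {n : ℕ} (a : K) (b : Fin n → K)
    {D : Matrix (Fin n) (Fin n) K} (h : ∀ i j, j < i → D i j = 0) :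
    ∀ i j, j < i → borderedMatrix a b 0 D i j = 0 := by
  intro i j
  cases i using Fin.cases <;> cases j using Fin.cases <;> simp
  exact h _ _

theorem borderedMatrix_lower {K : Type*} [Zero K] {n : ℕ} (a : K) (c : Fin n → K)
    {D : Matrix (Fin n) (Fin n) K} (h : ∀ i j, i < j → D i j = 0) :
    ∀ i j, i < j → borderedMatrix a 0 c D i j = 0 := by
  intro i j
  cases i using Fin.cases <;> cases j using Fin.cases <;> simp
  exact h _ _

open scoped Matrix in
theorem borderedMatrix_mul {K : Type*} [Semiring K] {n : ℕ} (a a' : K) (b b' c c' : Fin n → K)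
    (D D' : Matrix (Fin n) (Fin n) K) :
    borderedMatrix a b c D * borderedMatrix a' b' c' D' =
      borderedMatrix (a * a' + b ⬝ᵥ c') (a • b' + b ᵥ* D') (fun i => c i * a' + (D *ᵥ c') i)
        (Matrix.vecMulVec c b' + D * D') := by
  ext i j
  cases i using Fin.cases <;> cases j using Fin.cases <;>
    simp [Matrix.mul_apply, Fin.sum_univ_succ, dotProduct, Matrix.vecMul, Matrix.mulVec,
      Matrix.vecMulVec_apply]

theorem borderedMatrix_eta {K : Type*} {n : ℕ} (A : Matrix (Fin (n + 1)) (Fin (n + 1)) K) :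
    borderedMatrix (A 0 0) (fun j => A 0 j.succ) (fun i => A i.succ 0)
      (Matrix.of fun i j => A i.succ j.succ) = A := by
  ext i j
  cases i using Fin.cases <;> cases j using Fin.cases <;> rfl

theorem borderedMatrix_one {K : Type*} [Zero K] [One K] {n : ℕ} :
    borderedMatrix (1 : K) (0 : Fin n → K) 0 1 = 1 := by
  ext i j
  cases i using Fin.cases <;> cases j using Fin.cases <;>
    simp [Matrix.one_apply, Fin.succ_ne_zero, (Fin.succ_ne_zero _).symm]

theorem mul_upper {K : Type*} [NonUnitalNonAssocSemiring K] {n : ℕ}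
    {U V : Matrix (Fin n) (Fin n) K}
    (hU : ∀ i j, j < i → U i j = 0) (hV : ∀ i j, j < i → V i j = 0) :
    ∀ i j, j < i → (U * V) i j = 0 := by
  intro i j hij
  rw [Matrix.mul_apply]
  refine Finset.sum_eq_zero fun k _ => ?_
  rcases lt_or_ge k i with h | h
  · rw [hU i k h, zero_mul]
  · rw [hV k j (hij.trans_le h), mul_zero]

/-- An invertible upper triangular row operation makes the corner entry a pivot, unless the
first column vanishes. -/
theorem exists_upper_mul_pivot {K : Type*} [Field K] {n : ℕ}
    (A : Matrix (Fin (n + 1)) (Fin (n + 1)) K) :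
    ∃ V W B : Matrix (Fin (n + 1)) (Fin (n + 1)) K,
      (∀ i j, j < i → V i j = 0) ∧ V * W = 1 ∧ A = V * B ∧
        (B 0 0 = 0 → ∀ i : Fin n, B i.succ 0 = 0) := by
  by_cases h : A 0 0 = 0 → ∀ i : Fin n, A i.succ 0 = 0
  · exact ⟨1, 1, A, fun i j hij => Matrix.one_apply_ne hij.ne', by simp, by simp, h⟩
  · push Not at h
    obtain ⟨h0, k, hk⟩ := h
    have hne : (0 : Fin (n + 1)) ≠ k.succ := (Fin.succ_ne_zero k).symm
    refine ⟨Matrix.transvection 0 k.succ (-1), Matrix.transvection 0 k.succ 1,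
      Matrix.transvection 0 k.succ 1 * A, fun i j hij => ?_, ?_, ?_, fun hB => ?_⟩
    · have hi : (0 : Fin (n + 1)) ≠ i := (Fin.zero_le j |>.trans_lt hij).ne
      simp [Matrix.transvection, Matrix.one_apply_ne hij.ne', hi]
    · rw [Matrix.transvection_mul_transvection_same _ _ hne]
      simp
    · rw [← Matrix.mul_assoc, Matrix.transvection_mul_transvection_same _ _ hne]
      simp
    · rw [Matrix.transvection_mul_apply_same, h0] at hB
      exact absurd (by simpa using hB) hk

open scoped Matrix in
/-- Every square matrix over a field is a product of an upper, a lower and an upper triangular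
matrix, the first of them invertible. -/
theorem exists_upper_mul_lower_mul_upper {K : Type*} [Field K] {n : ℕ}
    (A : Matrix (Fin n) (Fin n) K) :
    ∃ U W L U' : Matrix (Fin n) (Fin n) K,
      (∀ i j, j < i → U i j = 0) ∧ U * W = 1 ∧ (∀ i j, i < j → L i j = 0) ∧
        (∀ i j, j < i → U' i j = 0) ∧ A = U * L * U' := by
  induction n with
  | zero => exact ⟨1, 1, 1, 1, by simp, by simp, by simp, by simp, Subsingleton.elim _ _⟩
  | succ n ih =>
    obtain ⟨V, W, B, hV, hVW, rfl, hB⟩ := exists_upper_mul_pivot A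
    obtain ⟨a, b, c, D, rfl⟩ : ∃ a b c D, B = borderedMatrix a b c D :=
      ⟨_, _, _, _, (borderedMatrix_eta B).symm⟩
    simp only [borderedMatrix_zero_zero, borderedMatrix_succ_zero] at hB
    obtain ⟨U, X, L, U', hU, hUX, hL, hU', hD⟩ := ih (D - Matrix.vecMulVec (a⁻¹ • c) b)
    have hc : a • a⁻¹ • c = c := by
      by_cases ha : a = 0
      · rw [show c = 0 from funext (hB ha)]
        simp
      · exact smul_inv_smul₀ ha c
    refine ⟨V * borderedMatrix 1 0 0 U, borderedMatrix 1 0 0 X * W,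
      borderedMatrix 1 0 (X *ᵥ (a⁻¹ • c)) L, borderedMatrix a b 0 U',
      mul_upper hV (borderedMatrix_upper _ _ hU), ?_, borderedMatrix_lower _ _ hL,
      borderedMatrix_upper _ _ hU', ?_⟩
    · have h1 : borderedMatrix 1 0 0 U * borderedMatrix 1 0 0 X = 1 := by
        rw [borderedMatrix_mul, hUX, ← borderedMatrix_one]
        congr 1
        · simp
        · simp
        · ext i
          simp
        · simp
      rw [Matrix.mul_assoc, ← Matrix.mul_assoc _ _ W, h1, Matrix.one_mul, hVW]
    · have hUXc : U *ᵥ (X *ᵥ (a⁻¹ • c)) = a⁻¹ • c := by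
        rw [Matrix.mulVec_mulVec, hUX, Matrix.one_mulVec]
      rw [Matrix.mul_assoc, Matrix.mul_assoc]
      congr 1
      rw [← Matrix.mul_assoc, borderedMatrix_mul, borderedMatrix_mul]
      have hLU : Matrix.vecMulVec (a⁻¹ • c) b + U * L * U' = D := by
        rw [← hD, add_sub_cancel]
      congr 1
      · simp
      · simp
      · ext i
        simpa [hUXc, mul_comm] using (congrFun hc i).symm
      · have hcol : (fun i => (0 : Fin n → K) i * 1 + (U *ᵥ (X *ᵥ (a⁻¹ • c))) i) = a⁻¹ • c := by
          ext i
          simp [hUXc]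
        rw [hcol]
        simpa using hLU.symm

/-- Every `n×n` complex matrix is a product `L₁U₁L₂U₂L₃U₃L₄U₄` of four lower
triangular and four upper triangular matrices. -/
theorem stmt1 (n : ℕ) (A : Matrix (Fin n) (Fin n) ℂ) :
    ∃ L₁ L₂ L₃ L₄ U₁ U₂ U₃ U₄ : Matrix (Fin n) (Fin n) ℂ,
      (∀ i j : Fin n, i < j → L₁ i j = 0) ∧
      (∀ i j : Fin n, i < j → L₂ i j = 0) ∧
      (∀ i j : Fin n, i < j → L₃ i j = 0) ∧
      (∀ i j : Fin n, i < j → L₄ i j = 0) ∧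
      (∀ i j : Fin n, j < i → U₁ i j = 0) ∧
      (∀ i j : Fin n, j < i → U₂ i j = 0) ∧
      (∀ i j : Fin n, j < i → U₃ i j = 0) ∧
      (∀ i j : Fin n, j < i → U₄ i j = 0) ∧
      A = L₁ * U₁ * L₂ * U₂ * L₃ * U₃ * L₄ * U₄ := by
  obtain ⟨U, -, L, U', hU, -, hL, hU', h⟩ := exists_upper_mul_lower_mul_upper A
  have hlow : ∀ i j : Fin n, i < j → (1 : Matrix (Fin n) (Fin n) ℂ) i j = 0 :=
    fun i j hij => Matrix.one_apply_ne hij.ne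
  have hup : ∀ i j : Fin n, j < i → (1 : Matrix (Fin n) (Fin n) ℂ) i j = 0 :=
    fun i j hij => Matrix.one_apply_ne hij.ne'
  exact ⟨1, L, 1, 1, U, U', 1, 1, hlow, hL, hlow, hlow, hU, hU', hup, hup, by simpa using h⟩
end

section
/- Let 2 ≤ k ≤ n. There exists a polynomial P in the n² matrix entries that does not vanish identically on the space of upper k-diagonal n×n complex matrices, such that every upper k-diagonal matrix A with P(A) ≠ 0 is a product of k−1 upper bidiagonal matrices. -/
/-- An `n×n` matrix is upper `k`-diagonal: `A i j = 0` whenever `|i - j| ≥ k` or `i > j`. -/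
def IsUpperKDiagonal (n k : ℕ) (A : Matrix (Fin n) (Fin n) ℂ) : Prop :=
  ∀ i j : Fin n, ((j : ℤ) - (i : ℤ)).natAbs ≥ k ∨ j < i → A i j = 0

/-- The entries of a square matrix as a function on `ℕ × ℕ`, extended by zero. -/
def entry {n : ℕ} (A : Matrix (Fin n) (Fin n) ℂ) (i j : ℕ) : ℂ :=
  if h : i < n ∧ j < n then A ⟨i, h.1⟩ ⟨j, h.2⟩ else 0

/-- Column reduction clearing the `(m+1)`-st superdiagonal: a multiple of the reduced column `j`
is subtracted from column `j + 1`. The first argument after `a` is the column index. -/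
noncomputable def reduceCol (m : ℕ) (a : ℕ → ℕ → ℂ) : ℕ → ℕ → ℂ
  | 0, i => a i 0
  | j + 1, i =>
    a i (j + 1) -
      (if m ≤ j then a (j - m) (j + 1) / reduceCol m a j (j - m) else 0) * reduceCol m a j i

/-- The multiplier used by `reduceCol` to pass from column `j` to column `j + 1`. -/
noncomputable def multiplier (m : ℕ) (a : ℕ → ℕ → ℂ) (j : ℕ) : ℂ :=
  if m ≤ j then a (j - m) (j + 1) / reduceCol m a j (j - m) else 0

theorem reduceCol_succ (m : ℕ) (a : ℕ → ℕ → ℂ) (j i : ℕ) :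
    reduceCol m a (j + 1) i = a i (j + 1) - multiplier m a j * reduceCol m a j i := rfl

theorem reduceCol_eq_self {m : ℕ} {a : ℕ → ℕ → ℂ}
    (h : ∀ j, m ≤ j → a (j - m) (j + 1) = 0) (j i : ℕ) : reduceCol m a j i = a i j := by
  cases j with
  | zero => rfl
  | succ j =>
    have hb : multiplier m a j = 0 := by
      unfold multiplier
      split_ifs with hm
      · rw [h j hm, zero_div]
      · rfl
    rw [reduceCol_succ, hb, zero_mul, sub_zero]

theorem reduceCol_eq_zero {m N : ℕ} {a : ℕ → ℕ → ℂ}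
    (ha : ∀ i j, i + (m + 2) ≤ j ∨ j < i → a i j = 0)
    (hc : ∀ j, m ≤ j → j < N → reduceCol m a j (j - m) ≠ 0) (j : ℕ) (hj : j < N) :
    ∀ i, i + (m + 1) ≤ j ∨ j < i → reduceCol m a j i = 0 := by
  induction j with
  | zero =>
    intro i hi
    exact ha i 0 (by omega)
  | succ j ih =>
    intro i hi
    rw [reduceCol_succ]
    by_cases h : i + m = j
    · have hm : m ≤ j := by omega
      obtain rfl : i = j - m := by omega
      rw [multiplier, if_pos hm, div_mul_cancel₀ _ (hc j hm (by omega)), sub_self]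
    · rw [ha i (j + 1) (by omega), ih (by omega) i (by omega), mul_zero, sub_zero]

/-- A function of matrices agreeing, on a principal Zariski-open neighbourhood of `W`, with a
quotient of polynomials in the entries. -/
def RegularAt {n : ℕ} (W : Matrix (Fin n) (Fin n) ℂ)
    (f : Matrix (Fin n) (Fin n) ℂ → ℂ) : Prop :=
  ∃ N D : MvPolynomial (Fin n × Fin n) ℂ,
    MvPolynomial.eval (fun p => W p.1 p.2) D ≠ 0 ∧
      ∀ A : Matrix (Fin n) (Fin n) ℂ, MvPolynomial.eval (fun p => A p.1 p.2) D ≠ 0 →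
        f A = MvPolynomial.eval (fun p => A p.1 p.2) N / MvPolynomial.eval (fun p => A p.1 p.2) D

namespace RegularAt

variable {n : ℕ} {W : Matrix (Fin n) (Fin n) ℂ} {f g : Matrix (Fin n) (Fin n) ℂ → ℂ}

theorem const (c : ℂ) : RegularAt W fun _ => c :=
  ⟨MvPolynomial.C c, 1, by simp, by simp⟩

theorem entry (i j : ℕ) : RegularAt W fun A => entry A i j := by
  by_cases h : i < n ∧ j < n
  · exact ⟨MvPolynomial.X (⟨i, h.1⟩, ⟨j, h.2⟩), 1, by simp, by simp [_root_.entry, h]⟩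
  · simpa only [_root_.entry, h, dite_false] using const 0

theorem add (hf : RegularAt W f) (hg : RegularAt W g) : RegularAt W fun A => f A + g A := by
  obtain ⟨N, D, hD, hf⟩ := hf
  obtain ⟨N', D', hD', hg⟩ := hg
  refine ⟨N * D' + D * N', D * D', by simp [hD, hD'], fun A hA => ?_⟩
  rw [map_mul, mul_ne_zero_iff] at hA
  simp only [hf A hA.1, hg A hA.2, map_mul, map_add, div_add_div _ _ hA.1 hA.2]

theorem mul (hf : RegularAt W f) (hg : RegularAt W g) : RegularAt W fun A => f A * g A := by
  obtain ⟨N, D, hD, hf⟩ := hf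
  obtain ⟨N', D', hD', hg⟩ := hg
  refine ⟨N * N', D * D', by simp [hD, hD'], fun A hA => ?_⟩
  rw [map_mul, mul_ne_zero_iff] at hA
  simp only [hf A hA.1, hg A hA.2, map_mul, div_mul_div_comm]

theorem sub (hf : RegularAt W f) (hg : RegularAt W g) : RegularAt W fun A => f A - g A := by
  simpa [sub_eq_add_neg] using hf.add ((const (-1)).mul hg)

theorem inv (hf : RegularAt W f) (h : f W ≠ 0) : RegularAt W fun A => (f A)⁻¹ := by
  obtain ⟨N, D, hD, hf⟩ := hf
  have hN : MvPolynomial.eval (fun p => W p.1 p.2) N ≠ 0 := by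
    intro h0
    exact h (by rw [hf W hD, h0, zero_div])
  refine ⟨D * D, N * D, by simp [hN, hD], fun A hA => ?_⟩
  rw [map_mul, mul_ne_zero_iff] at hA
  simp only [hf A hA.2, map_mul, inv_div, mul_div_mul_right _ _ hA.2]

theorem div (hf : RegularAt W f) (hg : RegularAt W g) (h : g W ≠ 0) :
    RegularAt W fun A => f A / g A := by
  simpa [div_eq_mul_inv] using hf.mul (hg.inv h)

theorem prod {ι : Type*} (s : Finset ι) {f : ι → Matrix (Fin n) (Fin n) ℂ → ℂ}
    (hf : ∀ i ∈ s, RegularAt W (f i)) : RegularAt W fun A => ∏ i ∈ s, f i A := by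
  classical
  induction s using Finset.induction_on with
  | empty => simpa using const 1
  | insert i s hi ih =>
    simp only [Finset.prod_insert hi]
    exact (hf i (by simp)).mul (ih fun j hj => hf j (by simp [hj]))

theorem eval {σ : Type*} {F : σ → Matrix (Fin n) (Fin n) ℂ → ℂ}
    (hF : ∀ s, RegularAt W (F s)) (P : MvPolynomial σ ℂ) :
    RegularAt W fun A => MvPolynomial.eval (fun s => F s A) P := by
  induction P using MvPolynomial.induction_on with
  | C c => simpa using const c
  | add p q hp hq => simpa using hp.add hq
  | mul_X p s hp => simpa using hp.mul (hF s)

theorem exists_polynomial (hf : RegularAt W f) (h : f W ≠ 0) :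
    ∃ P : MvPolynomial (Fin n × Fin n) ℂ, MvPolynomial.eval (fun p => W p.1 p.2) P ≠ 0 ∧
      ∀ A : Matrix (Fin n) (Fin n) ℂ,
        MvPolynomial.eval (fun p => A p.1 p.2) P ≠ 0 → f A ≠ 0 := by
  obtain ⟨N, D, hD, hf⟩ := hf
  refine ⟨N * D, ?_, fun A hA => ?_⟩
  · rw [hf W hD] at h
    rw [map_mul]
    exact mul_ne_zero (div_ne_zero_iff.1 h).1 hD
  · rw [map_mul, mul_ne_zero_iff] at hA
    rw [hf A hA.2]
    exact div_ne_zero hA.1 hA.2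

theorem reduceCol {m : ℕ} (hW : ∀ j, m ≤ j → _root_.entry W (j - m) (j + 1) = 0)
    (hW' : ∀ j, m ≤ j → j < n → _root_.entry W (j - m) j ≠ 0) (j : ℕ) (hj : j < n) :
    ∀ i, RegularAt W fun A => reduceCol m (_root_.entry A) j i := by
  induction j with
  | zero => exact fun i => entry i 0
  | succ j ih =>
    intro i
    have ih := ih (by omega)
    simp only [reduceCol_succ, multiplier]
    refine (entry _ _).sub (RegularAt.mul ?_ (ih i))
    split_ifs with hm
    · refine (entry _ _).div (ih _) ?_
      rw [reduceCol_eq_self hW]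
      exact hW' j hm (by omega)
    · exact const 0

end RegularAt

/-- Two polynomials that are both nonzero somewhere on the space of upper `k`-diagonal matrices
are simultaneously nonzero somewhere on it. -/
theorem exists_eval_ne_zero_and {n k : ℕ} {P Q : MvPolynomial (Fin n × Fin n) ℂ}
    {V W : Matrix (Fin n) (Fin n) ℂ} (hV : IsUpperKDiagonal n k V) (hW : IsUpperKDiagonal n k W)
    (hP : MvPolynomial.eval (fun p => V p.1 p.2) P ≠ 0)
    (hQ : MvPolynomial.eval (fun p => W p.1 p.2) Q ≠ 0) :
    ∃ A, IsUpperKDiagonal n k A ∧ MvPolynomial.eval (fun p => A p.1 p.2) P ≠ 0 ∧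
      MvPolynomial.eval (fun p => A p.1 p.2) Q ≠ 0 := by
  let line : Fin n × Fin n → Polynomial ℂ := fun p =>
    Polynomial.C (V p.1 p.2) + Polynomial.X * Polynomial.C (W p.1 p.2 - V p.1 p.2)
  have key (R : MvPolynomial (Fin n × Fin n) ℂ) (t : ℂ) :
      (MvPolynomial.aeval line R).eval t =
        MvPolynomial.eval (fun p => (V + t • (W - V)) p.1 p.2) R := by
    rw [← Polynomial.coe_evalRingHom, MvPolynomial.aeval_def, MvPolynomial.hom_eval₂,
      MvPolynomial.eval, MvPolynomial.coe_eval₂Hom]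
    congr 1
    · ext c
      simp
    · ext p
      simp [line]
  have hP' : MvPolynomial.aeval line P ≠ 0 := by
    intro h
    have := key P 0
    simp [h] at this
    exact hP this.symm
  have hQ' : MvPolynomial.aeval line Q ≠ 0 := by
    intro h
    have := key Q 1
    simp [h] at this
    exact hQ this.symm
  obtain ⟨t, ht⟩ : ∃ t, (MvPolynomial.aeval line P * MvPolynomial.aeval line Q).eval t ≠ 0 := by
    by_contra! h
    exact mul_ne_zero hP' hQ' (Polynomial.funext fun t => by simpa using h t)
  rw [Polynomial.eval_mul, mul_ne_zero_iff, key, key] at ht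
  refine ⟨V + t • (W - V), fun i j h => ?_, ht⟩
  simp [hV i j h, hW i j h]

theorem IsUpperKDiagonal.entry_eq_zero {n k : ℕ} {A : Matrix (Fin n) (Fin n) ℂ}
    (hA : IsUpperKDiagonal n k A) {i j : ℕ} (h : i + k ≤ j ∨ j < i) : entry A i j = 0 := by
  unfold entry
  split_ifs with hij
  · apply hA
    rcases h with h | h
    · left
      simp only
      omega
    · right
      simpa using h
  · rfl

theorem IsUpperKDiagonal.of_entry {n k : ℕ} {A : Matrix (Fin n) (Fin n) ℂ}
    (h : ∀ i j : Fin n, (i : ℕ) + k ≤ j ∨ (j : ℕ) < i → A i j = 0) : IsUpperKDiagonal n k A := by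
  intro i j hij
  apply h
  rw [Fin.lt_def] at hij
  omega

theorem entry_apply {n : ℕ} (A : Matrix (Fin n) (Fin n) ℂ) (i j : Fin n) :
    entry A i j = A i j := by
  simp [entry]

/-- The matrix whose columns are the reduced columns of `A`. -/
noncomputable def reduce {n : ℕ} (m : ℕ) (A : Matrix (Fin n) (Fin n) ℂ) :
    Matrix (Fin n) (Fin n) ℂ :=
  Matrix.of fun i j => reduceCol m (entry A) j i

/-- The unit upper bidiagonal matrix recording the multipliers of `reduce`. -/
noncomputable def multiplierMatrix {n : ℕ} (m : ℕ) (A : Matrix (Fin n) (Fin n) ℂ) :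
    Matrix (Fin n) (Fin n) ℂ :=
  Matrix.of fun i j =>
    (if i = j then 1 else 0) + if (i : ℕ) + 1 = j then multiplier m (entry A) i else 0

theorem isUpperKDiagonal_multiplierMatrix {n : ℕ} (m : ℕ) (A : Matrix (Fin n) (Fin n) ℂ) :
    IsUpperKDiagonal n 2 (multiplierMatrix m A) := by
  refine .of_entry fun i j h => ?_
  rw [multiplierMatrix, Matrix.of_apply, if_neg (by rw [Fin.ext_iff]; omega), if_neg (by omega),
    add_zero]

theorem reduce_mul_multiplierMatrix {n : ℕ} (m : ℕ) (A : Matrix (Fin n) (Fin n) ℂ) :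
    reduce m A * multiplierMatrix m A = A := by
  ext i ⟨j, hj⟩
  simp only [Matrix.mul_apply, reduce, multiplierMatrix, Matrix.of_apply, mul_add, mul_ite,
    mul_one, mul_zero, Finset.sum_add_distrib, Finset.sum_ite_eq', Finset.mem_univ, if_true]
  cases j with
  | zero => simpa [reduceCol] using entry_apply A i ⟨0, hj⟩
  | succ j =>
    rw [Finset.sum_eq_single ⟨j, by omega⟩]
    · simpa [reduceCol_succ, mul_comm] using entry_apply A i ⟨j + 1, hj⟩
    · intro x _ hx
      rw [if_neg]
      intro h
      exact hx (Fin.ext (by simpa using h))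
    · simp

/-- The list form of generic factorization into `m + 1` upper bidiagonal matrices. -/
theorem exists_polynomial_factorization (n m : ℕ) :
    ∃ P : MvPolynomial (Fin n × Fin n) ℂ,
      (∃ A : Matrix (Fin n) (Fin n) ℂ, IsUpperKDiagonal n (m + 2) A ∧
        MvPolynomial.eval (fun p => A p.1 p.2) P ≠ 0) ∧
      (∀ A : Matrix (Fin n) (Fin n) ℂ, IsUpperKDiagonal n (m + 2) A →
        MvPolynomial.eval (fun p => A p.1 p.2) P ≠ 0 →
        ∃ l : List (Matrix (Fin n) (Fin n) ℂ), l.length = m + 1 ∧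
          (∀ B ∈ l, IsUpperKDiagonal n 2 B) ∧ A = l.prod) := by
  induction m with
  | zero =>
    exact ⟨1, ⟨0, fun _ _ _ => rfl, by simp⟩, fun A hA _ => ⟨[A], by simp, by simpa, by simp⟩⟩
  | succ m ih =>
    obtain ⟨P, ⟨V, hV, hPV⟩, hP⟩ := ih
    let s : Finset (Fin n × Fin n) := {p | (p.1 : ℕ) + (m + 1) = p.2}
    let U : Matrix (Fin n) (Fin n) ℂ := Matrix.of fun i j => if (i : ℕ) + (m + 1) = j then 1 else 0
    have hU : IsUpperKDiagonal n (m + 2) U :=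
      .of_entry fun i j h => if_neg (by omega)
    have hQU : MvPolynomial.eval (fun p => U p.1 p.2) (∏ p ∈ s, MvPolynomial.X p) ≠ 0 := by
      rw [map_prod]
      refine Finset.prod_ne_zero_iff.2 fun p hp => ?_
      simp only [s, Finset.mem_filter, Finset.mem_univ, true_and] at hp
      simp [U, hp]
    obtain ⟨W, hW, hPW, hQW⟩ := exists_eval_ne_zero_and hV hU hPV hQU
    have hW0 (j : ℕ) (hj : m + 1 ≤ j) : entry W (j - (m + 1)) (j + 1) = 0 :=
      hW.entry_eq_zero (by omega)
    have hW1 (j : ℕ) (hj : m + 1 ≤ j) (hjn : j < n) : entry W (j - (m + 1)) j ≠ 0 := by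
      rw [map_prod, Finset.prod_ne_zero_iff] at hQW
      have := hQW (⟨j - (m + 1), by omega⟩, ⟨j, hjn⟩) (by simp [s]; omega)
      rw [MvPolynomial.eval_X] at this
      rwa [entry, dif_pos ⟨by omega, hjn⟩]
    have hreg (p : Fin n × Fin n) : RegularAt W fun A => reduce (m + 1) A p.1 p.2 :=
      RegularAt.reduceCol hW0 hW1 p.2 p.2.2 p.1
    have hWself : reduce (m + 1) W = W := by
      ext i j
      simp [reduce, reduceCol_eq_self hW0, entry_apply]
    let f : Matrix (Fin n) (Fin n) ℂ → ℂ := fun A =>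
      MvPolynomial.eval (fun p => reduce (m + 1) A p.1 p.2) P *
        ∏ p ∈ s, reduce (m + 1) A p.1 p.2
    have hf : RegularAt W f :=
      (RegularAt.eval hreg P).mul (RegularAt.prod s fun p _ => hreg p)
    have hfW : f W ≠ 0 := by
      simp only [f, hWself]
      exact mul_ne_zero hPW (by simpa using hQW)
    obtain ⟨R, hRW, hR⟩ := hf.exists_polynomial hfW
    refine ⟨R, ⟨W, .of_entry fun i j h => ?_, hRW⟩, fun A hA hRA => ?_⟩
    · rw [← entry_apply W]
      exact hW.entry_eq_zero (by omega)
    · obtain ⟨hPA, hQA⟩ := mul_ne_zero_iff.1 (hR A hRA)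
      have hred : IsUpperKDiagonal n (m + 2) (reduce (m + 1) A) := by
        refine .of_entry fun i j h => ?_
        refine reduceCol_eq_zero (N := n) (fun i j hij => hA.entry_eq_zero hij)
          (fun j hj hjn => ?_) j j.2 i h
        exact Finset.prod_ne_zero_iff.1 hQA (⟨j - (m + 1), by omega⟩, ⟨j, hjn⟩)
          (by simp [s]; omega)
      obtain ⟨l, hl, hlB, hlA⟩ := hP _ hred hPA
      refine ⟨l ++ [multiplierMatrix (m + 1) A], by simp [hl], ?_, ?_⟩
      · intro B hB
        rcases List.mem_append.1 hB with hB | hB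
        · exact hlB B hB
        · rw [List.mem_singleton.1 hB]
          exact isUpperKDiagonal_multiplierMatrix _ A
      · rw [List.prod_append, ← hlA, List.prod_singleton, reduce_mul_multiplierMatrix]

/-- For `2 ≤ k ≤ n`, there is a polynomial `P` in the matrix entries, not
vanishing identically on the space of upper `k`-diagonal matrices, such that every upper
`k`-diagonal matrix `A` with `P(A) ≠ 0` is a product of `k-1` upper bidiagonal matrices. -/
theorem stmt2 (n k : ℕ) (hk : 2 ≤ k) (hkn : k ≤ n) :
    ∃ P : MvPolynomial (Fin n × Fin n) ℂ,
      (∃ A : Matrix (Fin n) (Fin n) ℂ, IsUpperKDiagonal n k A ∧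
        MvPolynomial.eval (fun p => A p.1 p.2) P ≠ 0) ∧
      (∀ A : Matrix (Fin n) (Fin n) ℂ, IsUpperKDiagonal n k A →
        MvPolynomial.eval (fun p => A p.1 p.2) P ≠ 0 →
        ∃ f : Fin (k - 1) → Matrix (Fin n) (Fin n) ℂ,
          (∀ i, IsUpperKDiagonal n 2 (f i)) ∧ A = (List.ofFn f).prod) := by
  obtain ⟨m, rfl⟩ := Nat.exists_eq_add_of_le' hk
  obtain ⟨P, hP0, hP⟩ := exists_polynomial_factorization n m
  refine ⟨P, hP0, fun A hA hPA => ?_⟩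
  obtain ⟨l, hl, hlB, rfl⟩ := hP A hA hPA
  have hlen : m + 2 - 1 = l.length := by omega
  rw [hlen]
  exact ⟨l.get, fun i => hlB _ (l.get_mem i), by rw [List.ofFn_get]⟩
end

section
/- Every invertible upper triangular n×n complex matrix is a product of 2n upper bidiagonal matrices. -/
/-- An `n×n` matrix is upper bidiagonal: `A i j = 0` whenever `|i - j| ≥ 2` or `i > j`. -/
def IsUpperBidiagonal (n : ℕ) (A : Matrix (Fin n) (Fin n) ℂ) : Prop :=
  ∀ i j : Fin n, ((j : ℤ) - (i : ℤ)).natAbs ≥ 2 ∨ j < i → A i j = 0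

/-- The diagonal sum `1 ⊕ A`. -/
def oneSum {n : ℕ} (A : Matrix (Fin n) (Fin n) ℂ) : Matrix (Fin (n + 1)) (Fin (n + 1)) ℂ :=
  Matrix.of (Fin.cons (Fin.cons 1 0) fun i => Fin.cons 0 (A i))

lemma oneSum_one {n : ℕ} : oneSum (1 : Matrix (Fin n) (Fin n) ℂ) = 1 := by
  ext i j
  refine Fin.cases ?_ (fun i => ?_) i <;> refine Fin.cases ?_ (fun j => ?_) j <;>
    simp [oneSum, Matrix.one_apply, (Fin.succ_ne_zero _).symm]

lemma oneSum_mul {n : ℕ} (A B : Matrix (Fin n) (Fin n) ℂ) :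
    oneSum (A * B) = oneSum A * oneSum B := by
  ext i j
  refine Fin.cases ?_ (fun i => ?_) i <;> refine Fin.cases ?_ (fun j => ?_) j <;>
    simp [oneSum, Matrix.mul_apply, Fin.sum_univ_succ]

lemma oneSum_list_prod {n : ℕ} (l : List (Matrix (Fin n) (Fin n) ℂ)) :
    oneSum l.prod = (l.map oneSum).prod := by
  induction l with
  | nil => simp [oneSum_one]
  | cons a l ih => simp [oneSum_mul, ih]

lemma IsUpperBidiagonal.oneSum {n : ℕ} {A : Matrix (Fin n) (Fin n) ℂ}
    (hA : IsUpperBidiagonal n A) : IsUpperBidiagonal (n + 1) (oneSum A) := by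
  intro i j
  refine Fin.cases ?_ (fun i => ?_) i <;> refine Fin.cases ?_ (fun j => ?_) j
  · simp
  · simp [_root_.oneSum]
  · simp [_root_.oneSum]
  · intro h
    have := hA i j (by simpa using h)
    simpa [_root_.oneSum] using this

lemma IsUpperBidiagonal.diagonal_mul {n : ℕ} {A : Matrix (Fin n) (Fin n) ℂ}
    (hA : IsUpperBidiagonal n A) (d : Fin n → ℂ) :
    IsUpperBidiagonal n (Matrix.diagonal d * A) := by
  intro i j h
  simp [hA i j h]

lemma IsUpperBidiagonal.mul_diagonal {n : ℕ} {A : Matrix (Fin n) (Fin n) ℂ}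
    (hA : IsUpperBidiagonal n A) (d : Fin n → ℂ) :
    IsUpperBidiagonal n (A * Matrix.diagonal d) := by
  intro i j h
  simp [hA i j h]

/-- `A` is a product of `m` upper bidiagonal matrices. -/
def IsBidiagonalProd {n : ℕ} (m : ℕ) (A : Matrix (Fin n) (Fin n) ℂ) : Prop :=
  ∃ l : List (Matrix (Fin n) (Fin n) ℂ),
    l.length = m ∧ (∀ B ∈ l, IsUpperBidiagonal n B) ∧ l.prod = A

namespace IsBidiagonalProd

variable {n m k : ℕ} {A B : Matrix (Fin n) (Fin n) ℂ}

lemma mul (hA : IsBidiagonalProd m A) (hB : IsBidiagonalProd k B) :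
    IsBidiagonalProd (m + k) (A * B) := by
  obtain ⟨l, rfl, hl, rfl⟩ := hA
  obtain ⟨l', rfl, hl', rfl⟩ := hB
  refine ⟨l ++ l', by simp, fun B hB => ?_, by simp⟩
  rcases List.mem_append.1 hB with h | h
  exacts [hl B h, hl' B h]

lemma isUpperBidiagonal_mul (hB : IsBidiagonalProd m B) (hA : IsUpperBidiagonal n A) :
    IsBidiagonalProd (m + 1) (A * B) := by
  obtain ⟨l, rfl, hl, rfl⟩ := hB
  exact ⟨A :: l, by simp, by simpa using ⟨hA, hl⟩, by simp⟩

lemma oneSum (hA : IsBidiagonalProd m A) : IsBidiagonalProd m (oneSum A) := by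
  obtain ⟨l, rfl, hl, rfl⟩ := hA
  refine ⟨l.map _root_.oneSum, by simp, fun B hB => ?_, (oneSum_list_prod l).symm⟩
  obtain ⟨C, hC, rfl⟩ := List.mem_map.1 hB
  exact (hl C hC).oneSum

lemma diagonal_mul (hA : IsBidiagonalProd (m + 1) A) (d : Fin n → ℂ) :
    IsBidiagonalProd (m + 1) (Matrix.diagonal d * A) := by
  obtain ⟨l, hm, hl, rfl⟩ := hA
  cases l with
  | nil => simp at hm
  | cons a l =>
    refine ⟨(Matrix.diagonal d * a) :: l, by simpa using hm, ?_, by simp [Matrix.mul_assoc]⟩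
    simp only [List.mem_cons, forall_eq_or_imp] at hl ⊢
    exact ⟨hl.1.diagonal_mul d, hl.2⟩

lemma mul_diagonal (hA : IsBidiagonalProd (m + 1) A) (d : Fin n → ℂ) :
    IsBidiagonalProd (m + 1) (A * Matrix.diagonal d) := by
  obtain ⟨l, hm, hl, rfl⟩ := hA
  induction l using List.reverseRecOn with
  | nil => simp at hm
  | append_singleton l a _ =>
    refine ⟨l ++ [a * Matrix.diagonal d], by simpa using hm, ?_, by simp [Matrix.mul_assoc]⟩
    intro B hB
    rcases List.mem_append.1 hB with h | h
    · exact hl B (by simp [h])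
    · rw [List.mem_singleton.1 h]
      exact (hl a (by simp)).mul_diagonal d

end IsBidiagonalProd

/-- The upper bidiagonal matrix with diagonal `d` and superdiagonal `s`. -/
def bidiagonal {n : ℕ} (d : Fin (n + 1) → ℂ) (s : Fin n → ℂ) :
    Matrix (Fin (n + 1)) (Fin (n + 1)) ℂ :=
  fun i => Fin.cons (if i = 0 then d 0 else 0) fun j =>
    (if i = j.succ then d j.succ else 0) + if i = j.castSucc then s j else 0

lemma isUpperBidiagonal_bidiagonal {n : ℕ} (d : Fin (n + 1) → ℂ) (s : Fin n → ℂ) :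
    IsUpperBidiagonal (n + 1) (bidiagonal d s) := by
  intro i j
  refine Fin.cases ?_ (fun j => ?_) j
  · intro h
    have : i ≠ 0 := by rintro rfl; simp at h
    simp [bidiagonal, this]
  · intro h
    have h1 : i ≠ j.succ := by rintro rfl; simp at h
    have h2 : i ≠ j.castSucc := by
      rintro rfl
      simp [Fin.lt_def] at h
    simp [bidiagonal, h1, h2]

lemma mul_bidiagonal_zero {n : ℕ} (A : Matrix (Fin (n + 1)) (Fin (n + 1)) ℂ)
    (d : Fin (n + 1) → ℂ) (s : Fin n → ℂ) (i : Fin (n + 1)) :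
    (A * bidiagonal d s) i 0 = A i 0 * d 0 := by
  simp [Matrix.mul_apply, bidiagonal]

lemma mul_bidiagonal_succ {n : ℕ} (A : Matrix (Fin (n + 1)) (Fin (n + 1)) ℂ)
    (d : Fin (n + 1) → ℂ) (s : Fin n → ℂ) (i : Fin (n + 1)) (j : Fin n) :
    (A * bidiagonal d s) i j.succ = A i j.succ * d j.succ + A i j.castSucc * s j := by
  simp [Matrix.mul_apply, bidiagonal, mul_add, Finset.sum_add_distrib]

/-- The upper triangular Pascal matrix. -/
def pascal (n : ℕ) : Matrix (Fin n) (Fin n) ℂ :=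
  fun i j => ((j : ℕ).choose i : ℂ)

lemma pascal_succ (n : ℕ) :
    pascal (n + 1) = bidiagonal (fun _ => 1) (fun _ => 1) * oneSum (pascal n) := by
  ext i j
  rw [Matrix.mul_apply, Fin.sum_univ_succ]
  refine Fin.cases ?_ (fun j => ?_) j
  · refine Fin.cases ?_ (fun i => ?_) i <;> simp [pascal, bidiagonal, oneSum]
  · have key : ∑ k : Fin n, (if i = k.castSucc then ((j : ℕ).choose k : ℂ) else 0) =
        ((j : ℕ).choose i : ℂ) := by
      refine Fin.lastCases ?_ (fun i => ?_) i
      · rw [Finset.sum_eq_zero fun k _ => if_neg (Fin.castSucc_lt_last k).ne']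
        simp [Nat.choose_eq_zero_of_lt j.2]
      · simp [Fin.castSucc_inj]
    have key' : ∑ k : Fin n, (if i = k.succ then ((j : ℕ).choose k : ℂ) else 0) +
        ((j : ℕ).choose i : ℂ) = ((j + 1 : ℕ).choose i : ℂ) := by
      refine Fin.cases ?_ (fun i => ?_) i
      · simp [(Fin.succ_ne_zero _).symm]
      · simp [Fin.succ_inj, Nat.choose_succ_succ]
    simp [pascal, bidiagonal, oneSum, add_mul, Finset.sum_add_distrib, ← key', ← key]

lemma isBidiagonalProd_pascal (n : ℕ) : IsBidiagonalProd n (pascal n) := by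
  induction n with
  | zero => exact ⟨[], rfl, by simp, Subsingleton.elim _ _⟩
  | succ n ih =>
    rw [pascal_succ]
    exact ih.oneSum.isUpperBidiagonal_mul (isUpperBidiagonal_bidiagonal _ _)

/-- The lower right block left after clearing the first row of `A` by column operations between
neighbouring columns. -/
noncomputable def clearFirstRow {n : ℕ} (A : Matrix (Fin (n + 1)) (Fin (n + 1)) ℂ) :
    Matrix (Fin n) (Fin n) ℂ :=
  fun i j => A i.succ j.succ - A i.succ j.castSucc * (A 0 j.succ / A 0 j.castSucc)

lemma clearFirstRow_pascal (n : ℕ) : clearFirstRow (pascal (n + 1)) = pascal n := by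
  ext i j
  simp [clearFirstRow, pascal, Nat.choose_succ_succ]

lemma mul_bidiagonal_eq_oneSum {n : ℕ} {A : Matrix (Fin (n + 1)) (Fin (n + 1)) ℂ}
    (hA : ∀ i j : Fin (n + 1), j < i → A i j = 0) (h0 : ∀ j, A 0 j ≠ 0) :
    A * bidiagonal (Fin.cons (A 0 0)⁻¹ fun _ => 1) (fun j => -(A 0 j.succ / A 0 j.castSucc)) =
      oneSum (clearFirstRow A) := by
  ext i j
  refine Fin.cases ?_ (fun j => ?_) j
  · rw [mul_bidiagonal_zero]
    refine Fin.cases ?_ (fun i => ?_) i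
    · simp [oneSum, h0]
    · simp [oneSum, hA i.succ 0 (Fin.succ_pos i)]
  · rw [mul_bidiagonal_succ]
    refine Fin.cases ?_ (fun i => ?_) i
    · have := h0 j.castSucc
      simp [oneSum]
      field_simp
      simp
    · simp [oneSum, clearFirstRow, sub_eq_add_neg]

open Filter Topology in
lemma tendsto_clearFirstRow_pascal (n : ℕ) :
    Tendsto clearFirstRow (𝓝 (pascal (n + 1))) (𝓝 (pascal n)) := by
  rw [← clearFirstRow_pascal n]
  have h (i j : Fin (n + 1)) : ContinuousAt
      (fun A : Matrix (Fin (n + 1)) (Fin (n + 1)) ℂ => A i j) (pascal (n + 1)) :=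
    (continuous_apply_apply i j).continuousAt
  refine tendsto_pi_nhds.2 fun i => tendsto_pi_nhds.2 fun j => ?_
  exact (h _ _).sub ((h _ _).mul ((h _ _).div (h _ _) (by simp [pascal])))

open Filter Topology in
/-- Upper triangular matrices near the Pascal matrix are inverses of products of `n` upper
bidiagonal matrices. -/
lemma eventually_exists_isBidiagonalProd_inverse (n : ℕ) :
    ∀ᶠ A in 𝓝 (pascal n), (∀ i j : Fin n, j < i → A i j = 0) →
      ∃ B, IsBidiagonalProd n B ∧ A * B = 1 := by
  induction n with
  | zero =>
    exact Eventually.of_forall fun A _ =>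
      ⟨1, ⟨[], rfl, by simp, rfl⟩, Subsingleton.elim _ _⟩
  | succ n ih =>
    have h0 : ∀ᶠ A in 𝓝 (pascal (n + 1)), ∀ j, A 0 j ≠ 0 :=
      eventually_all.2 fun j =>
        (continuous_apply_apply (0 : Fin (n + 1)) j).continuousAt.eventually_ne (by simp [pascal])
    filter_upwards [(tendsto_clearFirstRow_pascal n).eventually ih, h0] with A hA h0 hupper
    obtain ⟨B, hB, hAB⟩ := hA fun i j hij => by
      simp [clearFirstRow, hupper i.succ j.succ (Fin.succ_lt_succ_iff.2 hij),
        hupper i.succ j.castSucc (lt_trans (Fin.castSucc_lt_castSucc_iff.2 hij) Fin.castSucc_lt_succ)]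
    refine ⟨bidiagonal (Fin.cons (A 0 0)⁻¹ fun _ => 1) (fun j => -(A 0 j.succ / A 0 j.castSucc)) *
      oneSum B, hB.oneSum.isUpperBidiagonal_mul (isUpperBidiagonal_bidiagonal _ _), ?_⟩
    rw [← Matrix.mul_assoc, mul_bidiagonal_eq_oneSum hupper h0, ← oneSum_mul, hAB, oneSum_one]

open Filter Topology in
/-- The conjugates of an upper triangular `V` by `diag(t ^ i)` tend to the diagonal part of `V` as
`t → 0`; multiplying by the Pascal matrix thus brings a conjugate near the Pascal matrix. -/
lemma exists_isBidiagonalProd_conj {n : ℕ} (V : Matrix (Fin n) (Fin n) ℂ)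
    (hV : ∀ i j : Fin n, j < i → V i j = 0) (hd : ∀ i, V i i ≠ 0) :
    ∃ t : ℂ, t ≠ 0 ∧ ∃ B, IsBidiagonalProd n B ∧
      V * (Matrix.diagonal (fun i : Fin n => t ^ (i : ℕ)) *
        (Matrix.diagonal (fun i => (V i i)⁻¹) * pascal n)) * B =
      Matrix.diagonal (fun i : Fin n => t ^ (i : ℕ)) := by
  let K : ℂ → Matrix (Fin n) (Fin n) ℂ := fun t =>
    (Matrix.of fun i j : Fin n => t ^ ((j : ℕ) - (i : ℕ)) * V i j) *
      (Matrix.diagonal (fun i => (V i i)⁻¹) * pascal n)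
  have hK : Continuous K := by
    refine Continuous.matrix_mul (continuous_matrix fun i j => ?_) continuous_const
    simp only [Matrix.of_apply]
    fun_prop
  have hK0 : K 0 = pascal n := by
    have : (Matrix.of fun i j : Fin n => (0 : ℂ) ^ ((j : ℕ) - (i : ℕ)) * V i j) =
        Matrix.diagonal fun i => V i i := by
      ext i j
      rcases lt_trichotomy i j with h | rfl | h
      · have : (j : ℕ) - i ≠ 0 := by rw [Fin.lt_def] at h; omega
        simp [h.ne, this]
      · simp
      · simp [h.ne', hV i j h]
    simp only [K, this, ← Matrix.mul_assoc, Matrix.diagonal_mul_diagonal]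
    simp [hd]
  have hev := (hK.tendsto' 0 _ hK0).eventually (eventually_exists_isBidiagonalProd_inverse n)
  obtain ⟨t, ht, ht0⟩ :=
    ((hev.filter_mono nhdsWithin_le_nhds).and (self_mem_nhdsWithin : {0}ᶜ ∈ 𝓝[≠] (0 : ℂ))).exists
  obtain ⟨B, hB, hKB⟩ := ht fun i j hij => by
    refine (Matrix.mul_apply ..).trans ?_
    simp only [Matrix.diagonal_mul, Matrix.of_apply]
    refine Finset.sum_eq_zero fun k _ => ?_
    rcases lt_or_ge k i with h | h
    · simp [hV i k h]
    · have : (j : ℕ) < k := lt_of_lt_of_le hij h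
      simp [pascal, Nat.choose_eq_zero_of_lt this]
  refine ⟨t, ht0, B, hB, ?_⟩
  have hconj : V * Matrix.diagonal (fun i : Fin n => t ^ (i : ℕ)) =
      Matrix.diagonal (fun i : Fin n => t ^ (i : ℕ)) *
        Matrix.of fun i j : Fin n => t ^ ((j : ℕ) - (i : ℕ)) * V i j := by
    ext i j
    rw [Matrix.mul_diagonal, Matrix.diagonal_mul, Matrix.of_apply]
    rcases lt_or_ge j i with h | h
    · simp [hV i j h]
    · rw [← mul_assoc, ← pow_add, Nat.add_sub_cancel' h, mul_comm]
  rw [← Matrix.mul_assoc, hconj, Matrix.mul_assoc _ _ (_ * pascal n), Matrix.mul_assoc, hKB,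
    Matrix.mul_one]

/-- Every invertible upper triangular `n×n` complex matrix is a product of
`2n` upper bidiagonal matrices. -/
theorem stmt3 (n : ℕ) (A : Matrix (Fin n) (Fin n) ℂ) (hA : IsUnit A)
    (hupper : ∀ i j : Fin n, j < i → A i j = 0) :
    ∃ f : Fin (2 * n) → Matrix (Fin n) (Fin n) ℂ,
      (∀ i, IsUpperBidiagonal n (f i)) ∧ A = (List.ofFn f).prod := by
  suffices h : IsBidiagonalProd (2 * n) A by
    obtain ⟨l, hm, hl, rfl⟩ := h
    rw [← hm]
    exact ⟨l.get, fun i => hl _ (l.get_mem i), by rw [List.ofFn_get]⟩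
  obtain _ | n := n
  · exact ⟨[], rfl, by simp, Subsingleton.elim _ _⟩
  have := hA.invertible
  have hV : ∀ i j, j < i → A⁻¹ i j = 0 := fun i j hij =>
    Matrix.blockTriangular_inv_of_blockTriangular (b := id) (fun i j h => hupper i j h) hij
  have hd : ∀ i, A⁻¹ i i ≠ 0 := by
    have hdet : A⁻¹.det ≠ 0 :=
      ((Matrix.isUnit_iff_isUnit_det _).1 (Matrix.isUnit_nonsing_inv_iff.2 hA)).ne_zero
    rw [Matrix.det_of_isUpperTriangular (fun i j h => hV i j h)] at hdet
    exact fun i => Finset.prod_ne_zero_iff.1 hdet i (Finset.mem_univ i)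
  obtain ⟨t, ht, B, hB, h⟩ := exists_isBidiagonalProd_conj A⁻¹ hV hd
  have hprod := (((isBidiagonalProd_pascal (n + 1)).diagonal_mul
    fun i => (A⁻¹ i i)⁻¹).diagonal_mul fun i : Fin (n + 1) => t ^ (i : ℕ)).mul
      (hB.mul_diagonal fun i : Fin (n + 1) => (t ^ (i : ℕ))⁻¹)
  rw [← two_mul] at hprod
  convert hprod using 1
  rw [Matrix.mul_assoc, Matrix.inv_mul_eq_iff_eq_mul_of_invertible] at h
  rw [← Matrix.mul_assoc, h, Matrix.mul_assoc, Matrix.diagonal_mul_diagonal]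
  simp [ht]
end

section
/- Every invertible n×n complex matrix is a product of 4n bidiagonal matrices. -/
/-- An `n×n` matrix is bidiagonal (2-diagonal): `A i j = 0` whenever `|i - j| ≥ 2`. -/
def IsBidiagonal (n : ℕ) (A : Matrix (Fin n) (Fin n) ℂ) : Prop :=
  ∀ i j : Fin n, ((i : ℤ) - (j : ℤ)).natAbs ≥ 2 → A i j = 0

/-- The zero pattern reached after `t` rounds of parallel Givens elimination: round `t` clears
the entries `(i, j)` below the diagonal with `(n - 1 - i) + 2 * j = t`. -/
def ClearedUpTo (n t : ℕ) (M : Matrix (Fin n) (Fin n) ℂ) : Prop :=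
  ∀ i j : Fin n, (j : ℕ) < i → n + 2 * (j : ℕ) < t + i + 1 → M i j = 0

lemma exists_reflection (x y : ℂ) :
    ∃ (c : ℝ) (s : ℂ), (c : ℂ) * c + s * star s = 1 ∧ star s * x = c * y := by
  by_cases hx : x = 0
  · exact ⟨0, 1, by simp, by simp [hx]⟩
  have hx' : (0 : ℝ) < ‖x‖ := norm_pos_iff.2 hx
  set r : ℝ := √(‖x‖ ^ 2 + ‖y‖ ^ 2)
  have hpos : 0 < ‖x‖ ^ 2 + ‖y‖ ^ 2 := by positivity
  have hr0 : 0 < r := Real.sqrt_pos.2 hpos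
  have hr2 : r ^ 2 = ‖x‖ ^ 2 + ‖y‖ ^ 2 := Real.sq_sqrt hpos.le
  refine ⟨‖x‖ / r, star (y * (‖x‖ : ℂ) / (x * r)), ?_, ?_⟩
  · rw [star_star, mul_comm (star _), ← starRingEnd_apply, Complex.mul_conj']
    have h : ‖y * (‖x‖ : ℂ) / (x * r)‖ = ‖y‖ / r := by
      simp only [norm_div, norm_mul, Complex.norm_real, norm_norm, Real.norm_of_nonneg hr0.le]
      field_simp
    rw [h]
    norm_cast
    rw [← sq, div_pow, div_pow, ← add_div, ← hr2, div_self (by positivity)]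
  · rw [star_star]
    have : (r : ℂ) ≠ 0 := by exact_mod_cast hr0.ne'
    push_cast
    field_simp

/-- The matrix acting as `α i` on the `i`-th coordinate and mixing it with coordinate `σ i`
through `β i`. -/
def pairMatrix {n : ℕ} (σ : Fin n → Fin n) (α β : Fin n → ℂ) : Matrix (Fin n) (Fin n) ℂ :=
  fun i k => (if k = i then α i else 0) + (if k = σ i then β i else 0)

lemma pairMatrix_mul_apply {n : ℕ} (σ : Fin n → Fin n) (α β : Fin n → ℂ)
    (M : Matrix (Fin n) (Fin n) ℂ) (i j : Fin n) :
    (pairMatrix σ α β * M) i j = α i * M i j + β i * M (σ i) j := by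
  simp [Matrix.mul_apply, pairMatrix, add_mul, Finset.sum_add_distrib]

lemma pairMatrix_mul_self {n : ℕ} {σ : Fin n → Fin n} {α β : Fin n → ℂ}
    (hσ : ∀ i, σ (σ i) = i) (h₁ : ∀ i, α i * α i + β i * β (σ i) = 1)
    (h₂ : ∀ i, β i * (α i + α (σ i)) = 0) :
    pairMatrix σ α β * pairMatrix σ α β = 1 := by
  ext i j
  rw [pairMatrix_mul_apply, Matrix.one_apply]
  simp only [pairMatrix, hσ]
  have e₁ := h₁ i
  have e₂ := h₂ i
  simp only [eq_comm (a := i) (b := j)]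
  split_ifs
  · linear_combination e₁ + e₂
  · linear_combination e₁
  · linear_combination e₂
  · ring

lemma pairMatrix_conjTranspose {n : ℕ} {σ : Fin n → Fin n} {α β : Fin n → ℂ}
    (hσ : ∀ i, σ (σ i) = i) (hα : ∀ i, star (α i) = α i) (hβ : ∀ i, β (σ i) = star (β i)) :
    (pairMatrix σ α β).conjTranspose = pairMatrix σ α β := by
  ext i j
  simp only [Matrix.conjTranspose_apply, pairMatrix, star_add]
  have hij : i = σ j ↔ j = σ i := ⟨fun h => by rw [h, hσ], fun h => by rw [h, hσ]⟩
  congr 1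
  · by_cases h : i = j
    · subst h; simp [hα]
    · simp [h, Ne.symm h]
  · by_cases h : j = σ i
    · subst h; simp [hσ, hβ]
    · simp [h, hij]

lemma pairMatrix_isBidiagonal {n : ℕ} {σ : Fin n → Fin n} {α β : Fin n → ℂ}
    (hσ : ∀ i : Fin n, ((i : ℤ) - (σ i : ℤ)).natAbs < 2) : IsBidiagonal n (pairMatrix σ α β) := by
  intro i j hij
  have h₁ : j ≠ i := by rintro rfl; simp at hij
  have h₂ : j ≠ σ i := by rintro rfl; exact absurd (hσ i) (by omega)
  simp [pairMatrix, h₁, h₂]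

/-- One round of parallel Givens elimination. -/
lemma exists_elimination_round {n t : ℕ} {M : Matrix (Fin n) (Fin n) ℂ}
    (hM : ClearedUpTo n t M) :
    ∃ G : Matrix (Fin n) (Fin n) ℂ, IsBidiagonal n G ∧ G.conjTranspose = G ∧ G * G = 1 ∧
      ClearedUpTo n (t + 1) (G * M) := by
  have key : ∀ i : Fin n, ∃ (c : ℝ) (s : ℂ), (c : ℂ) * c + s * star s = 1 ∧
      (∀ k j : Fin n, (k : ℕ) + 1 = i → (j : ℕ) < i → n + 2 * (j : ℕ) = t + i + 1 →
        star s * M k j = c * M i j) ∧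
      (s ≠ 0 → ∃ j : Fin n, (j : ℕ) < i ∧ n + 2 * (j : ℕ) = t + i + 1) := by
    intro i
    by_cases h : ∃ j : Fin n, (j : ℕ) < i ∧ n + 2 * (j : ℕ) = t + i + 1
    · obtain ⟨j, hj, hjt⟩ := h
      obtain ⟨c, s, h₁, h₂⟩ := exists_reflection (M ⟨i - 1, by omega⟩ j) (M i j)
      refine ⟨c, s, h₁, fun k j' hk hj' hjt' => ?_, fun _ => ⟨j, hj, hjt⟩⟩
      obtain rfl : j' = j := Fin.ext (by omega)
      have hk' : k = ⟨i - 1, by omega⟩ := Fin.ext (by simp; omega)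
      rw [hk']
      exact h₂
    · exact ⟨1, 0, by simp, fun k j _ hj hjt => absurd ⟨j, hj, hjt⟩ h, fun h0 => absurd rfl h0⟩
  choose c s hcs hkill hact using key
  have hs0 : ∀ i : Fin n, (i : ℕ) = 0 → s i = 0 := by
    intro i hi
    by_contra h
    obtain ⟨j, hj, -⟩ := hact i h
    omega
  let low : Fin n → Prop := fun i => (n + t + i + 1) % 2 = 0
  have : DecidablePred low := fun i => inferInstanceAs (Decidable (_ = _))
  let σ : Fin n → Fin n := fun i =>
    if low i then ⟨i - 1, by omega⟩ else if h : (i : ℕ) + 1 < n then ⟨i + 1, h⟩ else i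
  let α : Fin n → ℂ := fun i =>
    if low i then -(c i : ℂ) else if h : (i : ℕ) + 1 < n then (c ⟨i + 1, h⟩ : ℂ) else 1
  let β : Fin n → ℂ := fun i =>
    if low i then star (s i) else if h : (i : ℕ) + 1 < n then s ⟨i + 1, h⟩ else 0
  -- A coordinate is the lower or the upper one of a pair, or unpaired at either end.
  have pairing : ∀ i : Fin n,
      (∃ k : Fin n, (k : ℕ) + 1 = i ∧ low i ∧ σ i = k ∧ σ k = i ∧ α i = -(c i : ℂ) ∧
        α k = c i ∧ β i = star (s i) ∧ β k = s i) ∨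
      (∃ k : Fin n, (i : ℕ) + 1 = k ∧ low k ∧ ¬ low i ∧ σ i = k ∧ σ k = i ∧ α i = c k ∧
        α k = -(c k : ℂ) ∧ β i = s k ∧ β k = star (s k)) ∨
      (((i : ℕ) = 0 ∨ ¬ low i) ∧ σ i = i ∧ β i = 0 ∧ α i * α i = 1 ∧ star (α i) = α i) := by
    intro i
    by_cases hl : low i
    · by_cases hi : (i : ℕ) = 0
      · right; right
        have hc := hcs i
        rw [hs0 i hi] at hc
        refine ⟨Or.inl hi, ?_, ?_, ?_, ?_⟩
        · simp only [σ, if_pos hl]; ext; simp [hi]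
        · simp only [β, if_pos hl, hs0 i hi, star_zero]
        · simp only [α, if_pos hl]; linear_combination hc
        · simp [α, if_pos hl]
      · left
        have hl' : ¬ low ⟨i - 1, by omega⟩ := by simp only [low] at hl ⊢; omega
        have h1 : (i : ℕ) - 1 + 1 < n := by omega
        have h2 : (⟨(i : ℕ) - 1 + 1, h1⟩ : Fin n) = i := Fin.ext (by simp; omega)
        refine ⟨⟨i - 1, by omega⟩, by simp; omega, hl, ?_⟩
        simp only [σ, α, β, if_pos hl, if_neg hl', dif_pos h1, h2, and_self]
    · by_cases h : (i : ℕ) + 1 < n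
      · right; left
        have hl' : low ⟨i + 1, h⟩ := by simp only [low] at hl ⊢; omega
        refine ⟨⟨i + 1, h⟩, rfl, hl', hl, ?_⟩
        simp [σ, α, β, if_pos hl', if_neg hl, dif_pos h]
      · right; right
        simp [σ, α, β, if_neg hl, dif_neg h, hl]
  have hreal : ∀ i, star ((c i : ℝ) : ℂ) = c i := fun i => Complex.conj_ofReal _
  have hσ : ∀ i, σ (σ i) = i := by
    intro i
    rcases pairing i with ⟨k, h⟩ | ⟨k, h⟩ | h <;> grind
  refine ⟨pairMatrix σ α β, pairMatrix_isBidiagonal fun i => ?_,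
    pairMatrix_conjTranspose hσ (fun i => ?_) (fun i => ?_),
    pairMatrix_mul_self hσ (fun i => ?_) (fun i => ?_), fun i j hji hjt => ?_⟩
  · rcases pairing i with ⟨k, hk, -, h, -⟩ | ⟨k, hk, -, -, h, -⟩ | ⟨-, h, -⟩ <;> rw [h] <;> omega
  · rcases pairing i with ⟨k, hk, -, -, -, h, -⟩ | ⟨k, hk, -, -, -, -, h, -⟩ | ⟨-, -, -, -, h⟩
    · rw [h, star_neg, hreal]
    · rw [h, hreal]
    · exact h
  · rcases pairing i with ⟨k, hk, -, h, -, -, -, hi, hk⟩ | ⟨k, hk, -, -, h, -, -, -, hi, hk⟩ |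
      ⟨-, h, h0, -⟩
    · rw [h, hi, hk, star_star]
    · rw [h, hi, hk]
    · rw [h, h0, star_zero]
  · rcases pairing i with ⟨k, hk, -, h, -, ha, -, hi, hk⟩ | ⟨k, hk, -, -, h, -, ha, -, hi, hk⟩ |
      ⟨-, h, h0, h1, -⟩
    · rw [h, hi, hk, ha]; linear_combination hcs i
    · rw [h, hi, hk, ha]; linear_combination hcs k
    · rw [h, h0, h1]; simp
  · rcases pairing i with ⟨k, hk, -, h, -, ha, hb, -⟩ | ⟨k, hk, -, -, h, -, ha, hb, -⟩ |
      ⟨-, h, h0, -⟩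
    · rw [h, ha, hb]; ring
    · rw [h, ha, hb]; ring
    · rw [h0]; simp
  · rw [pairMatrix_mul_apply]
    rcases pairing i with ⟨k, hk, hl, h, -, ha, -, hb, -⟩ | ⟨k, hk, hl, -, h, -, ha, -, hb, -⟩ |
      ⟨hl, h, h0, -⟩
    · rw [h, ha, hb]
      by_cases hjt' : n + 2 * (j : ℕ) = t + i + 1
      · linear_combination hkill i k j hk hji hjt'
      · rw [hM i j hji (by omega)]
        by_cases hs : s i = 0
        · simp [hs]
        · obtain ⟨j', hj', hjt₂⟩ := hact i hs
          simp only [low] at hl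
          rw [hM k j (by omega) (by omega)]
          simp
    · simp only [low] at hl
      rw [h, hM i j hji (by omega), hM k j (by omega) (by omega)]
      simp
    · rw [h0, hM i j hji (by simp only [low] at hl; omega)]
      simp

lemma exists_elimination {n : ℕ} (t : ℕ) {M : Matrix (Fin n) (Fin n) ℂ}
    (hM : M ∈ Matrix.unitaryGroup (Fin n) ℂ) :
    ∃ (l : List (Matrix (Fin n) (Fin n) ℂ)) (R : Matrix (Fin n) (Fin n) ℂ),
      l.length = t ∧ (∀ B ∈ l, IsBidiagonal n B) ∧ R ∈ Matrix.unitaryGroup (Fin n) ℂ ∧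
      ClearedUpTo n t R ∧ M = l.prod * R := by
  induction t with
  | zero => exact ⟨[], M, rfl, by simp, hM, fun i j _ h => by omega, by simp⟩
  | succ t ih =>
    obtain ⟨l, R, hl, hb, hR, hcl, rfl⟩ := ih
    obtain ⟨G, hG, hGs, hGG, hGR⟩ := exists_elimination_round hcl
    have hGu : G ∈ Matrix.unitaryGroup (Fin n) ℂ := by
      rw [Matrix.mem_unitaryGroup_iff, Matrix.star_eq_conjTranspose, hGs, hGG]
    refine ⟨l ++ [G], G * R, by simp [hl], ?_, mul_mem hGu hR, hGR, ?_⟩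
    · intro B hB
      rcases List.mem_append.1 hB with h | h
      · exact hb B h
      · rw [List.mem_singleton.1 h]; exact hG
    · rw [List.prod_append, List.prod_singleton, mul_assoc, ← mul_assoc G, hGG, one_mul]

lemma isBidiagonal_of_unitary_of_blockTriangular {n : ℕ} {R : Matrix (Fin n) (Fin n) ℂ}
    (hR : R ∈ Matrix.unitaryGroup (Fin n) ℂ) (h : R.BlockTriangular id) :
    IsBidiagonal n R := by
  have h1 : R * star R = 1 := Matrix.mem_unitaryGroup_iff.1 hR
  have : Invertible R := invertibleOfRightInverse _ _ h1
  have h2 : (R⁻¹).BlockTriangular id := Matrix.blockTriangular_inv_of_blockTriangular h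
  rw [Matrix.inv_eq_right_inv h1] at h2
  intro i j hij
  rcases lt_trichotomy i j with hlt | rfl | hlt
  · have := h2 hlt
    rwa [Matrix.star_apply, star_eq_zero] at this
  · simp at hij
  · exact h hlt

/-- A unitary matrix is a product of `2n - 1` bidiagonal matrices. -/
lemma exists_bidiagonal_list_of_unitary {n : ℕ} (hn : 0 < n) {M : Matrix (Fin n) (Fin n) ℂ}
    (hM : M ∈ Matrix.unitaryGroup (Fin n) ℂ) :
    ∃ l : List (Matrix (Fin n) (Fin n) ℂ),
      l.length = 2 * n - 1 ∧ (∀ B ∈ l, IsBidiagonal n B) ∧ M = l.prod := by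
  obtain ⟨l, R, hl, hb, hR, hcl, rfl⟩ := exists_elimination (2 * n - 2) hM
  refine ⟨l ++ [R], by simp [hl]; omega, ?_, by simp⟩
  intro B hB
  rcases List.mem_append.1 hB with h | h
  · exact hb B h
  · rw [List.mem_singleton.1 h]
    refine isBidiagonal_of_unitary_of_blockTriangular hR fun i j hij => hcl i j hij ?_
    have : (j : ℕ) < i := hij
    omega

lemma isBidiagonal_diagonal {n : ℕ} (d : Fin n → ℂ) : IsBidiagonal n (Matrix.diagonal d) := by
  intro i j hij
  exact Matrix.diagonal_apply_ne _ (by rintro rfl; simp at hij)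

open scoped ComplexOrder in
/-- Singular value decomposition of an invertible matrix. -/
lemma exists_unitary_mul_diagonal_mul_unitary {n : ℕ} {A : Matrix (Fin n) (Fin n) ℂ}
    (hA : IsUnit A) :
    ∃ U ∈ Matrix.unitaryGroup (Fin n) ℂ, ∃ V ∈ Matrix.unitaryGroup (Fin n) ℂ,
      ∃ d : Fin n → ℂ, A = U * Matrix.diagonal d * V := by
  have hH : (star A * A).PosDef := by
    rw [Matrix.star_eq_conjTranspose]
    exact Matrix.PosDef.conjTranspose_mul_self A (Matrix.mulVec_injective_iff_isUnit.2 hA)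
  set W := hH.isHermitian.eigenvectorUnitary
  set e := hH.isHermitian.eigenvalues
  have he : ∀ i, 0 < e i := hH.eigenvalues_pos
  let d : Fin n → ℂ := fun i => (√(e i) : ℝ)
  let d' : Fin n → ℂ := fun i => ((√(e i))⁻¹ : ℝ)
  have hd : ∀ i, √(e i) ≠ 0 := fun i => (Real.sqrt_pos.2 (he i)).ne'
  have hWW : star (W : Matrix (Fin n) (Fin n) ℂ) * W = 1 := Matrix.mem_unitaryGroup_iff'.1 W.2
  have hWW' : (W : Matrix (Fin n) (Fin n) ℂ) * star (W : Matrix (Fin n) (Fin n) ℂ) = 1 :=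
    Matrix.mem_unitaryGroup_iff.1 W.2
  have hspec : star A * A =
      (W : Matrix (Fin n) (Fin n) ℂ) * Matrix.diagonal (fun i => (e i : ℂ)) *
        star (W : Matrix (Fin n) (Fin n) ℂ) :=
    hH.isHermitian.spectral_theorem
  have hdd : Matrix.diagonal d' * Matrix.diagonal d = 1 := by
    rw [Matrix.diagonal_mul_diagonal, ← Matrix.diagonal_one]
    congr 1; ext i
    simp only [d, d', ← Complex.ofReal_mul, inv_mul_cancel₀ (hd i), Complex.ofReal_one]
  have hstar : star (Matrix.diagonal d') = Matrix.diagonal d' := by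
    rw [Matrix.star_eq_conjTranspose, Matrix.diagonal_conjTranspose]
    congr 1; ext i
    exact Complex.conj_ofReal _
  have hded : Matrix.diagonal d' * Matrix.diagonal (fun i => (e i : ℂ)) * Matrix.diagonal d' =
      1 := by
    rw [Matrix.diagonal_mul_diagonal, Matrix.diagonal_mul_diagonal, ← Matrix.diagonal_one]
    congr 1; ext i
    simp only [d', ← Complex.ofReal_mul]
    norm_cast
    have := Real.mul_self_sqrt (he i).le
    have := hd i
    field_simp
    nlinarith
  refine ⟨A * W * Matrix.diagonal d', ?_, star (W : Matrix (Fin n) (Fin n) ℂ),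
    Unitary.star_mem W.2, d, ?_⟩
  · rw [Matrix.mem_unitaryGroup_iff', star_mul, star_mul, hstar]
    calc Matrix.diagonal d' * (star (W : Matrix (Fin n) (Fin n) ℂ) * star A) *
          (A * W * Matrix.diagonal d')
        = Matrix.diagonal d' * (star (W : Matrix (Fin n) (Fin n) ℂ) * (star A * A) * W) *
            Matrix.diagonal d' := by simp only [mul_assoc]
      _ = Matrix.diagonal d' * ((star (W : Matrix (Fin n) (Fin n) ℂ) * W) *
            Matrix.diagonal (fun i => (e i : ℂ)) * (star (W : Matrix (Fin n) (Fin n) ℂ) * W)) *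
            Matrix.diagonal d' := by rw [hspec]; simp only [mul_assoc]
      _ = 1 := by rw [hWW, one_mul, mul_one, hded]
  · rw [mul_assoc (A * _), hdd, mul_one, mul_assoc, hWW', mul_one]

/-- Every invertible `n×n` complex matrix is a product of `4n` bidiagonal
matrices. -/
theorem stmt5 (n : ℕ) (A : Matrix (Fin n) (Fin n) ℂ) (hA : IsUnit A) :
    ∃ f : Fin (4 * n) → Matrix (Fin n) (Fin n) ℂ,
      (∀ i, IsBidiagonal n (f i)) ∧ A = (List.ofFn f).prod := by
  rcases Nat.eq_zero_or_pos n with rfl | hn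
  · exact ⟨fun _ => 1, fun _ i => i.elim0, Subsingleton.elim _ _⟩
  obtain ⟨U, hU, V, hV, d, rfl⟩ := exists_unitary_mul_diagonal_mul_unitary hA
  obtain ⟨l, hl, hlb, rfl⟩ := exists_bidiagonal_list_of_unitary hn hU
  obtain ⟨m, hm, hmb, rfl⟩ := exists_bidiagonal_list_of_unitary hn hV
  set L := l ++ [Matrix.diagonal d] ++ m ++ [1] with hL
  have hlen : L.length = 4 * n := by simp [hL, hl, hm]; omega
  have hLb : ∀ B ∈ L, IsBidiagonal n B := by
    intro B hB
    simp only [hL, List.mem_append, List.mem_singleton] at hB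
    rcases hB with ((h | rfl) | h) | rfl
    · exact hlb B h
    · exact isBidiagonal_diagonal d
    · exact hmb B h
    · rw [← Matrix.diagonal_one]; exact isBidiagonal_diagonal _
  have hprod : l.prod * Matrix.diagonal d * m.prod = L.prod := by simp [hL, mul_assoc]
  rw [hprod, ← hlen]
  exact ⟨L.get, fun i => hLb _ (L.get_mem i), by rw [List.ofFn_get]⟩
end

section
/- Let n ≥ 2 and let r be a positive integer such that every n×n complex matrix is a product of r bidiagonal matrices. Then r ≥ n − 1. -/
/-- A product of `r` bidiagonal matrices is `(r + 1)`-diagonal. -/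
theorem list_prod_apply_eq_zero_of_isBidiagonal {n : ℕ}
    (l : List (Matrix (Fin n) (Fin n) ℂ)) (hl : ∀ A ∈ l, IsBidiagonal n A) (i j : Fin n)
    (hij : l.length + 1 ≤ ((i : ℤ) - (j : ℤ)).natAbs) : l.prod i j = 0 := by
  induction l generalizing i with
  | nil =>
    rw [List.prod_nil, Matrix.one_apply_ne]
    rintro rfl
    simp at hij
  | cons A l ih =>
    rw [List.prod_cons, Matrix.mul_apply]
    refine Finset.sum_eq_zero fun k _ => ?_
    rw [List.length_cons] at hij
    by_cases hik : ((i : ℤ) - (k : ℤ)).natAbs ≥ 2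
    · rw [hl A (by simp) i k hik, zero_mul]
    · rw [ih (fun B hB => hl B (by simp [hB])) k (by omega), mul_zero]

/-- If `n ≥ 2` and every `n×n` complex matrix is a product of `r` bidiagonal
matrices, then `r ≥ n - 1`. -/
theorem stmt7 (n : ℕ) (hn : 2 ≤ n) (r : ℕ) (hr : 0 < r)
    (h : ∀ A : Matrix (Fin n) (Fin n) ℂ,
      ∃ f : Fin r → Matrix (Fin n) (Fin n) ℂ,
        (∀ i, IsBidiagonal n (f i)) ∧ A = (List.ofFn f).prod) :
    n - 1 ≤ r := by
  by_contra! hlt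
  obtain ⟨f, hf, hprod⟩ := h (Matrix.of fun _ _ => 1)
  have hzero := list_prod_apply_eq_zero_of_isBidiagonal (List.ofFn f)
    (by simpa [List.mem_ofFn] using hf) ⟨0, by omega⟩ ⟨n - 1, by omega⟩
    (by simp only [List.length_ofFn]; omega)
  rw [← hprod] at hzero
  simp at hzero
end

section
/- Let n be even and r a positive integer with either (n ≥ 8 and r ≥ 3), or (n = 6 and r ≥ 4), or (n = 4 and r ≥ 5). Then there exists a nonzero polynomial P in the n² matrix entries such that every n×n complex matrix A with P(A) ≠ 0 is a product of r skew symmetric matrices. -/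
/-- A dominant polynomial map between complex affine spaces hits every point outside a proper
hypersurface. -/
theorem exists_forall_eval_ne_zero_of_injective {σ τ : Type*} [Finite σ] [Finite τ]
    (F : σ → MvPolynomial τ ℂ) (hF : Function.Injective (MvPolynomial.aeval (R := ℂ) F)) :
    ∃ P : MvPolynomial σ ℂ, P ≠ 0 ∧
      ∀ x, MvPolynomial.eval x P ≠ 0 → ∃ y, ∀ s, MvPolynomial.eval y (F s) = x s := by
  set φ : MvPolynomial σ ℂ →ₐ[ℂ] MvPolynomial τ ℂ := MvPolynomial.aeval F
  have hφ : φ.toRingHom.FinitePresentation := by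
    algebraize [φ.toRingHom]
    have : IsScalarTower ℂ (MvPolynomial σ ℂ) (MvPolynomial τ ℂ) :=
      IsScalarTower.of_algebraMap_eq fun r => (φ.commutes r).symm
    exact Algebra.FinitePresentation.of_restrict_scalars_finitePresentation ℂ _ _
  obtain ⟨D, hD⟩ := PrimeSpectrum.exists_constructibleSetData_iff.mpr
    (PrimeSpectrum.isConstructible_range_comap hφ)
  have hbot : (⊥ : PrimeSpectrum (MvPolynomial σ ℂ)) ∈ D.toSet := by
    rw [hD]
    refine ⟨⊥, ?_⟩
    ext1
    exact (RingHom.ker_eq_comap_bot φ.toRingHom).symm.trans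
      ((RingHom.injective_iff_ker_eq_bot _).1 hF)
  simp only [PrimeSpectrum.ConstructibleSetData.toSet, Set.mem_iUnion] at hbot
  obtain ⟨C, hC, hmem⟩ := hbot
  have hg : ∀ i, C.g i = 0 := fun i => by
    have := hmem.1 (Set.mem_range_self i)
    simpa using this
  have hf : C.f ≠ 0 := fun h => hmem.2 (by simp [h])
  refine ⟨C.f, hf, fun x hx => ?_⟩
  have hmax : (MvPolynomial.vanishingIdeal ℂ {x} : Ideal (MvPolynomial σ ℂ)).IsMaximal :=
    MvPolynomial.isMaximal_iff_eq_vanishingIdeal_singleton.2 ⟨x, rfl⟩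
  have hin : (⟨MvPolynomial.vanishingIdeal ℂ {x}, hmax.isPrime⟩ :
      PrimeSpectrum (MvPolynomial σ ℂ)) ∈ D.toSet := by
    simp only [PrimeSpectrum.ConstructibleSetData.toSet, Set.mem_iUnion]
    refine ⟨C, hC, ?_, ?_⟩
    · rintro _ ⟨i, rfl⟩
      simp [hg i]
    · simpa [MvPolynomial.mem_vanishingIdeal_singleton_iff, MvPolynomial.aeval_eq_eval] using hx
  rw [hD] at hin
  obtain ⟨q, hq⟩ := hin
  obtain ⟨J, hJ, hqJ⟩ := q.asIdeal.exists_le_maximal q.isPrime.ne_top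
  obtain ⟨y, rfl⟩ := MvPolynomial.isMaximal_iff_eq_vanishingIdeal_singleton.1 hJ
  refine ⟨y, fun s => ?_⟩
  have hx : MvPolynomial.X s - MvPolynomial.C (x s) ∈ MvPolynomial.vanishingIdeal ℂ {x} := by
    simp
  have hq' := congrArg PrimeSpectrum.asIdeal hq
  simp only [PrimeSpectrum.comap_asIdeal] at hq'
  rw [← hq'] at hx
  have := hqJ (Ideal.mem_comap.1 hx)
  simp only [AlgHom.toRingHom_eq_coe, RingHom.coe_coe,
    MvPolynomial.mem_vanishingIdeal_singleton_iff] at this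
  simpa [φ, sub_eq_zero, MvPolynomial.aeval_eq_eval] using this

/-- A complex polynomial vanishing on a neighbourhood of a point is zero. -/
theorem MvPolynomial.eq_zero_of_eventually_eval_eq_zero {σ : Type*} [Finite σ]
    {P : MvPolynomial σ ℂ} {x : σ → ℂ} (h : ∀ᶠ z in nhds x, MvPolynomial.eval z P = 0) :
    P = 0 := by
  have := Fintype.ofFinite σ
  obtain ⟨ε, hε, hball⟩ := Metric.eventually_nhds_iff_ball.1 h
  refine MvPolynomial.funext_set (fun i => Metric.ball (x i) ε) (fun i => ?_) fun z hz => ?_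
  · exact infinite_of_mem_nhds (x i) (Metric.ball_mem_nhds _ hε)
  · rw [map_zero]
    exact hball z (by rwa [← ball_pi _ hε] at hz)

/-- A polynomial map whose differential is surjective at one point is dominant. -/
theorem injective_aeval_of_range_fderiv_eq_top {σ τ : Type*} [Fintype σ] [Fintype τ]
    (F : σ → MvPolynomial τ ℂ) (y : τ → ℂ)
    (hy : (fderiv ℂ (fun z s => MvPolynomial.eval z (F s)) y).range = ⊤) :
    Function.Injective (MvPolynomial.aeval (R := ℂ) F) := by
  rw [injective_iff_map_eq_zero]
  intro P hP
  have hs : HasStrictFDerivAt (fun z s => MvPolynomial.eval z (F s))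
      (fderiv ℂ (fun z s => MvPolynomial.eval z (F s)) y) y := by
    refine ContDiffAt.hasStrictFDerivAt (n := 1) (ContDiff.contDiffAt ?_) one_ne_zero
    exact contDiff_pi.2 fun s => (AnalyticOnNhd.eval_mvPolynomial (F s)).contDiff
  refine MvPolynomial.eq_zero_of_eventually_eval_eq_zero
    (x := fun s => MvPolynomial.eval y (F s)) ?_
  rw [← hs.map_nhds_eq_of_surj hy, Filter.eventually_map]
  refine Filter.Eventually.of_forall fun z => ?_
  have := congrArg (MvPolynomial.eval z) hP
  rw [map_zero] at this
  rw [← this, ← MvPolynomial.aeval_eq_eval, ← MvPolynomial.aeval_eq_eval, ← AlgHom.comp_apply,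
    MvPolynomial.comp_aeval]

open Matrix

/-- Replacing one invertible factor of a product acts affinely on the product. -/
theorem prod_range_map_eq_of_eq_off {M : Type*} [Ring M] {S T : ℕ → M} {k : ℕ} (u : Mˣ)
    (hu : ((List.range (k + 1)).map S).prod = u)
    (hST : ∀ j, j ≠ k → T j = S j) {r : ℕ} (hr : k < r) :
    ((List.range r).map T).prod = ((List.range r).map S).prod +
      ((List.range k).map S).prod * (T k - S k) * (↑u⁻¹ * ((List.range r).map S).prod) := by
  have hk : ((List.range k).map T).prod = ((List.range k).map S).prod := by
    congr 1
    refine List.map_congr_left fun j hj => hST j ?_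
    exact (List.mem_range.1 hj).ne
  induction r, hr using Nat.le_induction with
  | base =>
    rw [hu, Units.inv_mul, ← hu, List.prod_range_succ, List.prod_range_succ, hk]
    noncomm_ring
  | succ j hj ih =>
    rw [List.prod_range_succ, ih, List.prod_range_succ S, hST j (by omega)]
    noncomm_ring

/-- If `C k = (S 0 ⋯ S (k-1))⁻¹ N (S 0 ⋯ S (k-1))` and every `(S k)⁻¹ C k` is symmetric, then
`N` is skew adjoint for each of the skew forms attached to the `S k`. -/
theorem isSymm_mul_of_conj {ι : Type*} [Fintype ι] [DecidableEq ι] {r : ℕ}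
    {S C W : ℕ → Matrix ι ι ℂ} {N : Matrix ι ι ℂ} (hS : ∀ k, (S k)ᵀ = -S k)
    (h0 : C 0 = N) (hC : ∀ k, C (k + 1) = W k * S k) (hW : ∀ k, C k = S k * W k)
    (hsymm : ∀ k < r, (W k).IsSymm) :
    (∀ k < r, Even k → (N * S k).IsSymm) ∧ (∀ k < r, Odd k → (S k * N).IsSymm) := by
  have key : ∀ k ≤ r, (Even k → C k = N) ∧ (Odd k → C k = -Nᵀ) := by
    intro k
    induction k with
    | zero => exact fun _ => ⟨fun _ => h0, fun h => absurd h (by decide)⟩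
    | succ k ih =>
      intro hk
      obtain ⟨he, ho⟩ := ih (by omega)
      have hstep : C (k + 1) = -(C k)ᵀ := by
        rw [hC, hW, transpose_mul, hS, (hsymm k (by omega)).eq, mul_neg, neg_neg]
      refine ⟨fun h => ?_, fun h => ?_⟩
      · rw [hstep, ho (by grind), transpose_neg, transpose_transpose, neg_neg]
      · rw [hstep, he (by grind)]
  have hsand : ∀ k < r, (S k * W k * S k).IsSymm := fun k hk => by
    simp [IsSymm, transpose_mul, hS, (hsymm k hk).eq, Matrix.mul_assoc]
  refine ⟨fun k hk h => ?_, fun k hk h => ?_⟩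
  · rw [← (key k hk.le).1 h, hW]
    exact hsand k hk
  · have : N = W k * S k := by
      have h1 := (key k hk.le).2 h
      rw [hW] at h1
      rw [← transpose_transpose N, ← neg_neg Nᵀ, ← h1, transpose_neg, transpose_mul, hS,
        (hsymm k hk).eq, mul_neg, neg_neg]
    rw [this, ← Matrix.mul_assoc]
    exact hsand k hk

/-- If no nonzero endomorphism is skew adjoint for all the skew forms attached to invertible skew
symmetric matrices `S 0, …, S (r-1)`, then a generic matrix is a product of `r` skew symmetric
matrices. -/
theorem exists_generic_eq_prod_of_forall_isSymm {ι : Type*} [Fintype ι] [DecidableEq ι] {r : ℕ}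
    {S : ℕ → Matrix ι ι ℂ} (hS : ∀ k, (S k)ᵀ = -S k) (hunit : ∀ k, IsUnit (S k))
    (h : ∀ N : Matrix ι ι ℂ, (∀ k < r, Even k → (N * S k).IsSymm) →
      (∀ k < r, Odd k → (S k * N).IsSymm) → N = 0) :
    ∃ P : MvPolynomial (ι × ι) ℂ, P ≠ 0 ∧
      ∀ A : Matrix ι ι ℂ, MvPolynomial.eval (fun p => A p.1 p.2) P ≠ 0 →
        ∃ f : Fin r → Matrix ι ι ℂ,
          (∀ i, (f i).transpose = -(f i)) ∧ A = (List.ofFn f).prod := by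
  let G : Fin r → Matrix ι ι (MvPolynomial (Fin r × ι × ι) ℂ) := fun k =>
    .of fun i j => .X (k, i, j) - .X (k, j, i)
  let F : ι × ι → MvPolynomial (Fin r × ι × ι) ℂ := fun p => (List.ofFn G).prod p.1 p.2
  let g : (Fin r × ι × ι → ℂ) → Fin r → Matrix ι ι ℂ := fun y k =>
    .of fun i j => y (k, i, j) - y (k, j, i)
  have hg : ∀ y k, (g y k)ᵀ = -g y k := fun y k => by ext; simp [g]
  have hFg : ∀ y p, MvPolynomial.eval y (F p) = (List.ofFn (g y)).prod p.1 p.2 := by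
    intro y p
    have h1 := map_list_prod (MvPolynomial.eval y).mapMatrix (List.ofFn G)
    have h2 : (List.ofFn G).map (MvPolynomial.eval y).mapMatrix = List.ofFn (g y) := by
      rw [List.map_ofFn]
      congr 1
      ext k i j
      simp [G, g]
    rw [h2] at h1
    exact congrFun (congrFun h1 p.1) p.2
  let y₀ : Fin r × ι × ι → ℂ := fun p => S p.1 p.2.1 p.2.2 / 2
  suffices hsurj : (fderiv ℂ (fun z s => MvPolynomial.eval z (F s)) y₀).range = ⊤ by
    obtain ⟨P, hP, hPA⟩ := exists_forall_eval_ne_zero_of_injective F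
      (injective_aeval_of_range_fderiv_eq_top F y₀ hsurj)
    refine ⟨P, hP, fun A hA => ?_⟩
    obtain ⟨y, hy⟩ := hPA _ hA
    refine ⟨g y, hg y, ?_⟩
    ext i j
    rw [← hy (i, j), hFg]
  by_contra hne
  obtain ⟨φ, hφ, hker⟩ := Submodule.exists_le_ker_of_lt_top _ (lt_top_iff_ne_top.2 hne)
  let M : Matrix ι ι ℂ := .of fun j i => φ (Pi.single (i, j) 1)
  have hφM : ∀ B : Matrix ι ι ℂ, φ (fun p => B p.1 p.2) = (B * M).trace := by
    intro B
    rw [LinearMap.pi_apply_eq_sum_univ φ, Fintype.sum_prod_type]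
    simp only [trace, diag_apply, mul_apply, M, of_apply, smul_eq_mul]
    refine Finset.sum_congr rfl fun i _ => Finset.sum_congr rfl fun j _ => ?_
    congr 2
    ext p
    simp [Pi.single_apply, eq_comm]
  choose U hU using hunit
  let V : ℕ → (Matrix ι ι ℂ)ˣ := fun k => ((List.range k).map U).prod
  let VI : ℕ → Matrix ι ι ℂ := fun k => ((V k)⁻¹ : (Matrix ι ι ℂ)ˣ)
  have hV : ∀ k, (V k : Matrix ι ι ℂ) = ((List.range k).map S).prod := fun k => by
    induction k with
    | zero => simp [V]
    | succ k ih =>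
      have : V (k + 1) = V k * U k := List.prod_range_succ _ _
      rw [this, Units.val_mul, ih, hU, List.prod_range_succ]
  have hVsucc : ∀ k, V (k + 1) = V k * U k := fun k => List.prod_range_succ _ _
  have hofFn : ∀ T : ℕ → Matrix ι ι ℂ,
      (List.ofFn fun k : Fin r => T k) = (List.range r).map T := fun T => by
    rw [List.ofFn_eq_map, ← List.map_coe_finRange_eq_range, List.map_map]
    rfl
  -- The differential in the direction of a single skew symmetric variation of the `k`-th factor.
  have hdir : ∀ (k : Fin r) (a b : ι),
      fderiv ℂ (fun z s => MvPolynomial.eval z (F s)) y₀ (Pi.single (k, a, b) 1) = fun p =>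
        ((V k : Matrix ι ι ℂ) * (single a b 1 - single b a 1) *
          (VI (k + 1) * (V r : Matrix ι ι ℂ)) : Matrix ι ι ℂ) p.1 p.2 := by
    intro k a b
    have hd : DifferentiableAt ℂ (fun z s => MvPolynomial.eval z (F s)) y₀ := by
      refine ContDiffAt.differentiableAt (n := 1) (ContDiff.contDiffAt ?_) one_ne_zero
      exact contDiff_pi.2 fun s => (AnalyticOnNhd.eval_mvPolynomial (F s)).contDiff
    rw [← hd.lineDeriv_eq_fderiv]
    refine HasLineDerivAt.lineDeriv ?_
    have hbase : List.ofFn (g y₀) = (List.range r).map S := by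
      rw [← hofFn]
      congr 1
      ext l i j
      have hskew := congrFun (congrFun (hS l) i) j
      simp only [transpose_apply, Matrix.neg_apply] at hskew
      simp only [g, y₀, of_apply, hskew]
      ring
    have hline : ∀ t : ℂ, (List.ofFn (g (y₀ + t • Pi.single (k, a, b) 1))) =
        (List.range r).map
          (Function.update S k (S k + t • (single a b 1 - single b a 1))) := by
      intro t
      rw [← hofFn]
      congr 1
      ext l i j
      have hskew := congrFun (congrFun (hS l) i) j
      simp only [transpose_apply, Matrix.neg_apply] at hskew
      by_cases hl : l = k
      · subst hl
        simp only [g, y₀, of_apply, Pi.add_apply, Pi.smul_apply, Pi.single_apply, hskew,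
          Function.update_self, Matrix.add_apply, Matrix.smul_apply, Matrix.sub_apply,
          single_apply, Prod.mk.injEq, true_and, smul_eq_mul, @eq_comm _ a, @eq_comm _ b,
          @and_comm (j = a)]
        ring
      · have hl' : (l : ℕ) ≠ k := fun h => hl (Fin.ext h)
        simp [g, y₀, hl, hl', hskew]
        ring
    refine hasDerivAt_pi.2 fun p => ?_
    simp only [hFg, hline]
    have hprod := fun t : ℂ => prod_range_map_eq_of_eq_off (V (k + 1)) (hV _).symm
      (T := Function.update S k (S k + t • (single a b 1 - single b a 1)))
      (fun j hj => Function.update_of_ne hj _ _) k.isLt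
    simp only [hprod, Function.update_self, add_sub_cancel_left, Matrix.mul_smul,
      Matrix.smul_mul, Matrix.add_apply, Matrix.smul_apply, smul_eq_mul, ← hV]
    refine HasDerivAt.const_add _ ?_
    simpa [VI] using (hasDerivAt_id (0 : ℂ)).mul_const _
  have hsymm : ∀ k < r, (VI (k + 1) * ((V r : Matrix ι ι ℂ) * M) *
      (V k : Matrix ι ι ℂ)).IsSymm := by
    intro k hk
    ext a b
    have := hker (LinearMap.mem_range_self _ (Pi.single ((⟨k, hk⟩ : Fin r), a, b) 1))
    rw [LinearMap.mem_ker, ContinuousLinearMap.coe_coe, hdir, hφM, Matrix.mul_assoc,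
      Matrix.mul_assoc, trace_mul_comm, Matrix.mul_assoc, Matrix.sub_mul, trace_sub,
      trace_single_mul, trace_single_mul, one_smul, one_smul, sub_eq_zero] at this
    simpa [Matrix.mul_assoc] using this
  have hN := isSymm_mul_of_conj (N := (V r : Matrix ι ι ℂ) * M) (r := r)
    (C := fun k => VI k * ((V r : Matrix ι ι ℂ) * M) *
      (V k : Matrix ι ι ℂ))
    (W := fun k => VI (k + 1) * ((V r : Matrix ι ι ℂ) * M) *
      (V k : Matrix ι ι ℂ)) hS (by simp [V, VI])
    (fun k => by simp only [hVsucc, Units.val_mul, hU, Matrix.mul_assoc])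
    (fun k => by
      simp only [VI, hVsucc, _root_.mul_inv_rev, Units.val_mul, ← hU, ← Matrix.mul_assoc,
        Units.mul_inv, Matrix.one_mul])
    hsymm
  have hM : M = 0 := by
    have := h _ hN.1 hN.2
    exact (Units.mul_right_eq_zero _).1 this
  refine hφ (LinearMap.ext fun v => ?_)
  have := hφM (.of fun i j => v (i, j))
  rw [hM] at this
  simpa using this

/-- The block matrix `[[a, b], [-bᵀ, 0]]`. -/
def skewBlock {κ : Type*} (a b : Matrix κ κ ℂ) : Matrix (κ ⊕ κ) (κ ⊕ κ) ℂ :=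
  fromBlocks a b (-bᵀ) 0

theorem skewBlock_transpose {κ : Type*} {a : Matrix κ κ ℂ} (ha : aᵀ = -a) (b : Matrix κ κ ℂ) :
    (skewBlock a b)ᵀ = -skewBlock a b := by
  simp [skewBlock, fromBlocks_transpose, fromBlocks_neg, ha]

theorem isUnit_skewBlock {κ : Type*} [Fintype κ] [DecidableEq κ] (a : Matrix κ κ ℂ)
    {b : Matrix κ κ ℂ} (hb : IsUnit b) : IsUnit (skewBlock a b) := by
  obtain ⟨u, rfl⟩ := hb
  set c : Matrix κ κ ℂ := ↑u⁻¹
  have h1 : (u : Matrix κ κ ℂ) * c = 1 := u.mul_inv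
  have h2 : (u : Matrix κ κ ℂ)ᵀ * cᵀ = 1 := by
    rw [← transpose_mul, u.inv_mul, transpose_one]
  have h3 : skewBlock a u * fromBlocks 0 (-cᵀ) c (c * a * cᵀ) = 1 := by
    rw [skewBlock, fromBlocks_multiply, ← fromBlocks_one]
    simp [h1, h2, ← Matrix.mul_assoc]
  exact (isUnit_iff_isUnit_det _).2 (isUnit_det_of_right_inverse h3)

theorem single_sub_single_transpose {κ : Type*} [DecidableEq κ] (u v : κ) :
    (single u v (1 : ℂ) - single v u 1)ᵀ = -(single u v (1 : ℂ) - single v u 1) := by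
  simp

/-- An endomorphism skew adjoint for a generic pair of skew forms is a sum of elements of
`sl₂`. -/
theorem exists_eq_fromBlocks_diagonal {κ : Type*} [Fintype κ] [DecidableEq κ] {l : κ → ℂ}
    (hl : Function.Injective l) {N : Matrix (κ ⊕ κ) (κ ⊕ κ) ℂ}
    (h1 : (N * skewBlock 0 1).IsSymm) (h2 : (N * skewBlock 0 (diagonal l)).IsSymm) :
    ∃ p q r : κ → ℂ, N = fromBlocks (diagonal p) (diagonal q) (diagonal r) (diagonal (-p)) := by
  obtain ⟨p, q, r, s, rfl⟩ : ∃ p q r s, N = fromBlocks p q r s :=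
    ⟨_, _, _, _, (fromBlocks_toBlocks N).symm⟩
  simp only [skewBlock, fromBlocks_multiply, IsSymm, fromBlocks_transpose, fromBlocks_inj] at h1 h2
  simp only [transpose_one, Matrix.mul_zero, Matrix.mul_neg, Matrix.mul_one, zero_add, add_zero,
    transpose_neg, diagonal_transpose, neg_inj] at h1 h2
  obtain ⟨hq, hs, hp, hr⟩ := h1
  obtain ⟨hq', hs', -, hr'⟩ := h2
  have hdiag : ∀ x : Matrix κ κ ℂ, (∀ i j, x i j * l j = x i j * l i) →
      x = diagonal fun i => x i i := by
    intro x hx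
    ext i j
    by_cases hij : i = j
    · subst hij; simp
    · rw [diagonal_apply_ne _ hij]
      by_contra h0
      exact hij (hl (mul_left_cancel₀ h0 (hx i j))).symm
  have hps : ∀ i j, s i j = -p j i := fun i j => by
    have : p j i = -s i j := congrFun (congrFun hp i) j
    rw [this, neg_neg]
  have hqd := hdiag q fun i j => by
    have e1 := congrFun (congrFun hq i) j
    have e2 := congrFun (congrFun hq' i) j
    simp only [transpose_apply, mul_diagonal] at e1 e2
    grind
  have hrd := hdiag r fun i j => by
    have e1 := congrFun (congrFun hr i) j
    have e2 := congrFun (congrFun hr' i) j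
    simp only [transpose_apply, mul_diagonal] at e1 e2
    grind
  have hpd := hdiag p fun i j => by
    have e2 := congrFun (congrFun hs' i) j
    have e1 := hps j i
    simp only [transpose_apply, mul_diagonal, Matrix.neg_apply] at e2
    grind
  refine ⟨fun i => p i i, fun i => q i i, fun i => r i i, ?_⟩
  rw [← hpd, ← hqd, ← hrd]
  congr 1
  ext i j
  rw [hps, hpd]
  by_cases hij : i = j
  · subst hij; simp
  · simp [hij, Ne.symm hij]

theorem isSymm_skewBlock_mul {κ : Type*} [Fintype κ] [DecidableEq κ] {a b : Matrix κ κ ℂ}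
    {p q r : κ → ℂ} (h : (skewBlock a b *
      fromBlocks (diagonal p) (diagonal q) (diagonal r) (diagonal (-p))).IsSymm) (i j : κ) :
    a i j * p j + b i j * r j = a j i * p i + b j i * r i ∧
      a i j * q j = b i j * (p j - p i) ∧ b j i * q j = b i j * q i := by
  simp only [skewBlock, fromBlocks_multiply, IsSymm, fromBlocks_transpose, fromBlocks_inj] at h
  obtain ⟨h1, -, h3, h4⟩ := h
  have e1 := congrFun (congrFun h1 j) i
  have e3 := congrFun (congrFun h3 j) i
  have e4 := congrFun (congrFun h4 j) i
  simp at e1 e3 e4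
  refine ⟨by linear_combination e1, by linear_combination e3, e4⟩

/-- Skew forms on `ℂ^(2m)` with trivial common stabilizer. -/
theorem exists_skew_family {m r : ℕ}
    (hcase : (4 ≤ m ∧ 3 ≤ r) ∨ (m = 3 ∧ 4 ≤ r) ∨ (m = 2 ∧ 5 ≤ r)) :
    ∃ S : ℕ → Matrix (Fin m ⊕ Fin m) (Fin m ⊕ Fin m) ℂ,
      (∀ k, (S k)ᵀ = -S k) ∧ (∀ k, IsUnit (S k)) ∧
      ∀ N, (∀ k < r, Even k → (N * S k).IsSymm) → (∀ k < r, Odd k → (S k * N).IsSymm) →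
        N = 0 := by
  obtain ⟨m, rfl⟩ : ∃ k, m = k + 2 := ⟨m - 2, by omega⟩
  let v : Fin (m + 2) := if h : m = 0 then 1 else ⟨2, by omega⟩
  have hv : v ≠ 0 := by
    by_cases h : m = 0
    · simp [v, h]
    · simp [v, h, Fin.ext_iff]
  let a : Matrix (Fin (m + 2)) (Fin (m + 2)) ℂ := single 0 v 1 - single v 0 1
  have ha : aᵀ = -a := single_sub_single_transpose _ _
  let a' : Matrix (Fin (m + 2)) (Fin (m + 2)) ℂ := if 2 ≤ m then a else 0
  have ha' : a'ᵀ = -a' := by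
    by_cases h : 2 ≤ m
    · simp only [a', if_pos h, ha]
    · simp [a', if_neg h]
  let b : Matrix (Fin (m + 2)) (Fin (m + 2)) ℂ := of fun i j => if i + 1 = j then 1 else 0
  have hb : IsUnit b := by
    have : b * bᵀ = 1 := by
      ext i j
      simp [b, mul_apply, one_apply, eq_comm]
    exact (isUnit_iff_isUnit_det _).2 (isUnit_det_of_right_inverse this)
  let l : Fin (m + 2) → ℂ := fun i => (i : ℕ) + 1
  have hl : Function.Injective l := fun i j h => by simpa [l, Fin.ext_iff] using h
  let S : ℕ → Matrix (Fin (m + 2) ⊕ Fin (m + 2)) (Fin (m + 2) ⊕ Fin (m + 2)) ℂ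
    | 1 => skewBlock a' b
    | 2 => skewBlock 0 (diagonal l)
    | 3 => skewBlock a 1
    | 4 => skewBlock a 1
    | _ => skewBlock 0 1
  refine ⟨S, fun k => ?_, fun k => ?_, fun N hE hO => ?_⟩
  · unfold S
    split <;> exact skewBlock_transpose (by simp [ha, ha']) _
  · have hld : IsUnit (diagonal l) := by
      refine isUnit_diagonal.2 (Pi.isUnit_iff.2 fun i => ?_)
      exact isUnit_iff_ne_zero.2 (Nat.cast_add_one_ne_zero _)
    unfold S
    split
    · exact isUnit_skewBlock _ hb
    · exact isUnit_skewBlock _ hld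
    all_goals exact isUnit_skewBlock _ isUnit_one
  obtain ⟨p, q, r', rfl⟩ := exists_eq_fromBlocks_diagonal hl
    (hE 0 (by omega) (by decide)) (hE 2 (by omega) (by decide))
  have hS1 := isSymm_skewBlock_mul (hO 1 (by omega) (by decide))
  have hedge : ∀ i, a' i (i + 1) = 0 := by
    intro i
    by_cases h : 2 ≤ m
    · have hm : m ≠ 0 := by omega
      simp only [a', if_pos h, a, v, dif_neg hm, Matrix.sub_apply, single_apply, Fin.ext_iff,
        Fin.val_add_one, Fin.val_zero, Fin.val_last]
      grind
    · simp [a', if_neg h]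
  have hpstep : ∀ i, p (i + 1) = p i := fun i => by
    have := (hS1 i (i + 1)).2.1
    simp only [hedge, b, of_apply, if_true] at this
    linear_combination -this
  have hpconst : ∀ i, p i = p 0 := by
    intro i
    induction i using Fin.induction with
    | zero => rfl
    | succ i ih => rw [← Fin.coeSucc_eq_succ, hpstep, ih]
  have hanti : a 0 v = 1 ∧ a v 0 = -1 := by
    simp [a, hv, hv.symm]
  have hzero : q = 0 → r' = 0 → (∃ s, a v 0 * p 0 + s * r' 0 = a 0 v * p v + s * r' v) →
      fromBlocks (diagonal p) (diagonal q) (diagonal r') (diagonal (-p)) = 0 := by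
    rintro rfl rfl ⟨s, hs⟩
    rw [hanti.1, hanti.2, hpconst v] at hs
    have hp0 : p 0 = 0 := by
      simp at hs
      linear_combination -hs / 2
    have : p = 0 := funext fun i => by rw [hpconst, hp0]; rfl
    simp [this]
  by_cases hm : m = 0
  · subst hm
    have hS3 := isSymm_skewBlock_mul (hO 3 (by omega) (by decide))
    have hS4 := hE 4 (by omega) (by decide)
    have hv1 : v = 1 := rfl
    have hq : ∀ i, q i = q 0 := by
      have := (hS1 0 1).2.2
      simpa [b, Fin.forall_fin_two] using this
    have hq0 : q 0 = 0 := by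
      have := (hS3 0 v).2.1
      simpa [hanti.1, hv.symm, hq v] using this
    have hp0 : p 0 = 0 := by
      have := (hS3 v 0).1
      simp only [hanti.1, hanti.2, hpconst v, one_apply_ne hv, one_apply_ne hv.symm] at this
      linear_combination -this / 2
    have hp : p = 0 := funext fun i => by rw [hpconst, hp0]; rfl
    have hr : r' = 0 := by
      simp only [S, skewBlock, fromBlocks_multiply, IsSymm, fromBlocks_transpose,
        fromBlocks_inj] at hS4
      have h3 := hS4.2.1
      have e0 := congrFun (congrFun h3 v) 0
      have e1 := congrFun (congrFun h3 0) v
      simp [hp, hanti] at e0 e1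
      refine funext (Fin.forall_fin_two.2 ⟨?_, ?_⟩) <;> simp_all
    exact hzero (funext fun i => by rw [hq, hq0]; rfl) hr ⟨0, by simp [hp]⟩
  · have hback : ∀ i : Fin (m + 2), i + 1 + 1 ≠ i := by
      intro i
      simp only [ne_eq, Fin.ext_iff, Fin.val_add_one, Fin.val_last]
      grind
    have hedge_symm : ∀ i, a' (i + 1) i = 0 := fun i => by
      have := congrFun (congrFun ha' i) (i + 1)
      simpa [hedge] using this
    have hr : r' = 0 := by
      have : ∀ i, r' (i + 1) = 0 := fun i => by
        have := (hS1 i (i + 1)).1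
        simpa [hedge, hedge_symm, b, hback] using this
      funext i
      simpa using this (i - 1)
    have hq : q = 0 := funext fun i => by
      have := (hS1 i (i + 1)).2.2
      simpa [b, hback] using this.symm
    refine hzero hq hr ?_
    by_cases h2 : 2 ≤ m
    · have := (hS1 v 0).1
      simp only [a', if_pos h2] at this
      exact ⟨0, by simpa [hr] using this⟩
    · exact ⟨0, by simpa [hr] using (isSymm_skewBlock_mul (hO 3 (by omega) (by decide)) v 0).1⟩

/-- For even `n` with (`n ≥ 8` and `r ≥ 3`), or (`n = 6` and `r ≥ 4`), or
(`n = 4` and `r ≥ 5`), there is a nonzero polynomial `P` in the matrix entries such that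
every `n×n` complex matrix `A` with `P(A) ≠ 0` is a product of `r` skew symmetric
matrices. -/
theorem stmt9 (n r : ℕ) (hn : Even n) (hr : 0 < r)
    (hcase : (8 ≤ n ∧ 3 ≤ r) ∨ (n = 6 ∧ 4 ≤ r) ∨ (n = 4 ∧ 5 ≤ r)) :
    ∃ P : MvPolynomial (Fin n × Fin n) ℂ, P ≠ 0 ∧
      ∀ A : Matrix (Fin n) (Fin n) ℂ,
        MvPolynomial.eval (fun p => A p.1 p.2) P ≠ 0 →
        ∃ f : Fin r → Matrix (Fin n) (Fin n) ℂ,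
          (∀ i, (f i).transpose = -(f i)) ∧ A = (List.ofFn f).prod := by
  obtain ⟨m, rfl⟩ := hn
  obtain ⟨S, hskew, hunit, hS⟩ := exists_skew_family (m := m) (r := r) (by omega)
  let e : Fin (m + m) ≃ Fin m ⊕ Fin m := finSumFinEquiv.symm
  refine exists_generic_eq_prod_of_forall_isSymm (S := fun k => (S k).submatrix e e)
    (fun k => by rw [transpose_submatrix, hskew, submatrix_neg]; rfl)
    (fun k => (isUnit_submatrix_equiv e e).2 (hunit k)) fun N hE hO => ?_
  have hNe : N = (N.submatrix e.symm e.symm).submatrix e e := by simp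
  have hsymm : ∀ M : Matrix (Fin m ⊕ Fin m) (Fin m ⊕ Fin m) ℂ,
      (M.submatrix e e).IsSymm → M.IsSymm := fun M hM => by
    simpa using hM.submatrix e.symm
  rw [hNe, hS (N.submatrix e.symm e.symm) (fun k hk h => hsymm _ ?_)
    (fun k hk h => hsymm _ ?_)]
  · simp
  · rw [← submatrix_mul_equiv _ _ e e e, ← hNe]
    exact hE k hk h
  · rw [← submatrix_mul_equiv _ _ e e e, ← hNe]
    exact hO k hk h
end

section
/- Let n be odd and r a positive integer with either (n ≥ 5 and r ≥ 3) or (n = 3 and r ≥ 4). Then there exists a polynomial P in the n² matrix entries that does not vanish identically on the set of n×n complex matrices of determinant zero, such that every n×n complex matrix A with det A = 0 and P(A) ≠ 0 is a product of r skew symmetric matrices. -/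
section SkewProducts

open scoped Matrix Matrix.Norms.Operator Topology

/-- A polynomial map with algebraically independent components hits every point outside a proper
hypersurface. -/
theorem AlgebraicIndependent.exists_forall_eval_ne_zero {σ τ : Type} [Finite σ] [Finite τ]
    {f : τ → MvPolynomial σ ℂ} (hf : AlgebraicIndependent ℂ f) :
    ∃ Q : MvPolynomial τ ℂ, Q ≠ 0 ∧ ∀ y : τ → ℂ, MvPolynomial.eval y Q ≠ 0 →
      ∃ x : σ → ℂ, ∀ i, MvPolynomial.eval x (f i) = y i := by
  set φ : MvPolynomial τ ℂ →ₐ[ℂ] MvPolynomial σ ℂ := MvPolynomial.aeval f with hφ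
  have hinj : Function.Injective φ := hf
  have hfp : φ.toRingHom.FinitePresentation := by
    refine RingHom.FinitePresentation.of_comp_finiteType (algebraMap ℂ (MvPolynomial τ ℂ)) ?_ ?_
    · have : φ.toRingHom.comp (algebraMap ℂ (MvPolynomial τ ℂ)) = algebraMap ℂ _ := by
        ext; simp
      rw [this, RingHom.finitePresentation_algebraMap]
      infer_instance
    · rw [RingHom.finiteType_algebraMap]
      infer_instance
  obtain ⟨S, hS⟩ := PrimeSpectrum.exists_constructibleSetData_iff.mpr
    (PrimeSpectrum.isConstructible_range_comap hfp)
  have hgen : (⊥ : PrimeSpectrum (MvPolynomial τ ℂ)) ∈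
      Set.range (PrimeSpectrum.comap φ.toRingHom) := by
    refine ⟨⊥, PrimeSpectrum.ext ?_⟩
    simpa [PrimeSpectrum.asIdeal_bot] using Ideal.comap_bot_of_injective φ.toRingHom hinj
  rw [← hS] at hgen
  simp only [PrimeSpectrum.ConstructibleSetData.toSet, Set.mem_iUnion] at hgen
  obtain ⟨C, hC, hgC, hfC⟩ := hgen
  have hg0 : ∀ i, C.g i = 0 := fun i => by
    have := hgC ⟨i, rfl⟩
    simpa [PrimeSpectrum.asIdeal_bot] using this
  refine ⟨C.f, fun h => hfC (by simp [h]), fun y hy => ?_⟩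
  let p : PrimeSpectrum (MvPolynomial τ ℂ) :=
    ⟨RingHom.ker (MvPolynomial.eval y), RingHom.ker_isPrime _⟩
  have hp : p ∈ Set.range (PrimeSpectrum.comap φ.toRingHom) := by
    rw [← hS]
    simp only [PrimeSpectrum.ConstructibleSetData.toSet, Set.mem_iUnion]
    refine ⟨C, hC, ?_, ?_⟩
    · rintro _ ⟨i, rfl⟩
      simp [hg0 i]
    · intro h
      exact hy (RingHom.mem_ker.mp (h rfl))
  obtain ⟨q, hq⟩ := hp
  obtain ⟨M, hM, hqM⟩ := Ideal.exists_le_maximal q.asIdeal q.isPrime.ne_top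
  obtain ⟨x, rfl⟩ := (MvPolynomial.isMaximal_iff_eq_vanishingIdeal_singleton (K := ℂ)).mp hM
  refine ⟨x, fun i => ?_⟩
  have h1 : (MvPolynomial.X i - MvPolynomial.C (y i) : MvPolynomial τ ℂ) ∈ p.asIdeal := by
    simp [p, RingHom.mem_ker]
  rw [← hq] at h1
  have h2 := hqM h1
  rw [MvPolynomial.mem_vanishingIdeal_singleton_iff] at h2
  simpa [hφ, sub_eq_zero, MvPolynomial.aeval_eq_eval] using h2

/-- Polynomials whose joint image contains an open set are algebraically independent. -/
theorem algebraicIndependent_of_range_mem_nhds {σ τ : Type} [Fintype τ]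
    {f : τ → MvPolynomial σ ℂ} {y : τ → ℂ}
    (h : Set.range (fun (x : σ → ℂ) i => MvPolynomial.eval x (f i)) ∈ 𝓝 y) :
    AlgebraicIndependent ℂ f := by
  rw [algebraicIndependent_iff]
  intro Q hQ
  obtain ⟨ε, hε, hball⟩ := Metric.mem_nhds_iff.mp h
  rw [ball_pi _ hε] at hball
  refine MvPolynomial.funext_set (fun i => Metric.ball (y i) ε)
    (fun i => infinite_of_mem_nhds (y i) (Metric.ball_mem_nhds _ hε)) fun z hz => ?_
  obtain ⟨x, rfl⟩ := hball hz
  have := congrArg (MvPolynomial.eval x) hQ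
  rw [map_zero] at this ⊢
  rw [← this, MvPolynomial.map_aeval]
  congr 1
  ext <;> simp

section Families

variable {ι κ : Type} [Fintype ι] [DecidableEq ι] [Fintype κ] [DecidableEq κ]

/-- The matrices that are products of `r` skew symmetric matrices. -/
def skewProducts (ι : Type) [Fintype ι] [DecidableEq ι] (r : ℕ) : Set (Matrix ι ι ℂ) :=
  {A | ∃ f : Fin r → Matrix ι ι ℂ, (∀ i, (f i)ᵀ = -(f i)) ∧ A = (List.ofFn f).prod}

theorem one_mem_skewProducts : (1 : Matrix ι ι ℂ) ∈ skewProducts ι 0 :=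
  ⟨Fin.elim0, fun i => i.elim0, by simp⟩

theorem mul_mem_skewProducts {r : ℕ} {S A : Matrix ι ι ℂ} (hS : Sᵀ = -S)
    (hA : A ∈ skewProducts ι r) : S * A ∈ skewProducts ι (r + 1) := by
  obtain ⟨f, hf, rfl⟩ := hA
  refine ⟨Fin.cons S f, fun i => ?_, by simp [List.ofFn_succ]⟩
  induction i using Fin.cases with
  | zero => simpa using hS
  | succ i => simpa using hf i

/-- There is a strictly differentiable family of products of `r` skew symmetric matrices through
`B` such that every matrix orthogonal (for the trace pairing) to all velocities of the family at
`B` satisfies `N`. -/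
def HasFamily (r : ℕ) (B : Matrix ι ι ℂ) (N : Matrix ι ι ℂ → Prop) : Prop :=
  ∃ (E : Type) (_ : NormedAddCommGroup E) (_ : NormedSpace ℂ E) (_ : CompleteSpace E)
    (F : E → Matrix ι ι ℂ) (F' : E →L[ℂ] Matrix ι ι ℂ) (x : E),
    F x = B ∧ (∀ y, F y ∈ skewProducts ι r) ∧ HasStrictFDerivAt F F' x ∧
      ∀ Z, (∀ dx, (Z * F' dx).trace = 0) → N Z

theorem HasFamily.mono {r : ℕ} {B : Matrix ι ι ℂ} {N N' : Matrix ι ι ℂ → Prop}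
    (h : HasFamily r B N) (hN : ∀ Z, N Z → N' Z) : HasFamily r B N' := by
  obtain ⟨E, i1, i2, i3, F, F', x, h1, h2, h3, h4⟩ := h
  exact ⟨E, i1, i2, i3, F, F', x, h1, h2, h3, fun Z hZ => hN Z (h4 Z hZ)⟩

theorem hasFamily_one : HasFamily 0 (1 : Matrix ι ι ℂ) fun _ => True :=
  ⟨Matrix ι ι ℂ, inferInstance, inferInstance, inferInstance, fun _ => 1, 0, 0, rfl,
    fun _ => one_mem_skewProducts, hasStrictFDerivAt_const _ _, fun _ _ => trivial⟩

theorem isSymm_of_forall_trace_skew {M : Matrix ι ι ℂ}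
    (h : ∀ K : Matrix ι ι ℂ, (M * (K - Kᵀ)).trace = 0) : M.IsSymm := by
  ext i j
  have := h (Matrix.single i j 1)
  simpa [mul_sub, Matrix.transpose_single, Matrix.trace_mul_single, sub_eq_zero] using this

/-- The map `M ↦ M - Mᵀ`, as a continuous linear map. -/
noncomputable def skewPart : Matrix ι ι ℂ →L[ℂ] Matrix ι ι ℂ :=
  LinearMap.toContinuousLinearMap
    (LinearMap.id - (Matrix.transposeLinearEquiv ι ι ℂ ℂ).toLinearMap)

@[simp]
theorem skewPart_apply {α : Type} [Fintype α] (M : Matrix α α ℂ) : skewPart M = M - Mᵀ := rfl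

theorem HasFamily.mul {r : ℕ} {B S : Matrix ι ι ℂ} {N : Matrix ι ι ℂ → Prop}
    (h : HasFamily r B N) (hS : Sᵀ = -S) :
    HasFamily (r + 1) (S * B) fun Z => N (Z * S) ∧ (B * Z).IsSymm := by
  obtain ⟨E, i1, i2, i3, F, F', x, rfl, h2, h3, h4⟩ := h
  have hx : skewPart ((2⁻¹ : ℂ) • S) = S := by
    rw [skewPart_apply, Matrix.transpose_smul, hS, smul_neg, sub_neg_eq_add, ← add_smul]
    norm_num
  have hfst : HasStrictFDerivAt (fun p : Matrix ι ι ℂ × E => skewPart p.1)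
      (skewPart.comp (ContinuousLinearMap.fst ℂ _ _)) ((2⁻¹ : ℂ) • S, x) :=
    (skewPart.comp (ContinuousLinearMap.fst ℂ (Matrix ι ι ℂ) E)).hasStrictFDerivAt
  have hsnd : HasStrictFDerivAt (fun p : Matrix ι ι ℂ × E => F p.2)
      (F'.comp (ContinuousLinearMap.snd ℂ _ _)) ((2⁻¹ : ℂ) • S, x) :=
    HasStrictFDerivAt.comp (f := Prod.snd) ((2⁻¹ : ℂ) • S, x) h3 hasStrictFDerivAt_snd
  refine ⟨Matrix ι ι ℂ × E, inferInstance, inferInstance, inferInstance,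
    fun p => skewPart p.1 * F p.2, _, ((2⁻¹ : ℂ) • S, x), by simp only [hx], fun p => ?_,
    hfst.mul' hsnd, fun Z hZ => ⟨h4 _ fun dx => ?_, isSymm_of_forall_trace_skew fun K => ?_⟩⟩
  · refine mul_mem_skewProducts ?_ (h2 _)
    simp
  · have : (Z * (skewPart ((2⁻¹ : ℂ) • S) * F' dx + skewPart 0 * F x)).trace = 0 := hZ (0, dx)
    simpa only [hx, map_zero, zero_mul, add_zero, mul_assoc] using this
  · have : (Z * (skewPart ((2⁻¹ : ℂ) • S) * F' 0 + skewPart K * F x)).trace = 0 := hZ (K, 0)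
    rw [mul_assoc, Matrix.trace_mul_comm, mul_assoc]
    simpa using this

/-- The positions in a bordered matrix other than the bottom right one. -/
abbrev OffCorner (κ : Type) : Type :=
  {p : (κ ⊕ Unit) × (κ ⊕ Unit) // p ≠ (.inr (), .inr ())}

/-- The entries of a matrix other than the bottom right one. -/
def offCorner (A : Matrix (κ ⊕ Unit) (κ ⊕ Unit) ℂ) (p : OffCorner κ) : ℂ :=
  A p.1.1 p.1.2

/-- `offCorner` as a continuous linear map. -/
noncomputable def offCornerL : Matrix (κ ⊕ Unit) (κ ⊕ Unit) ℂ →L[ℂ] (OffCorner κ → ℂ) :=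
  LinearMap.toContinuousLinearMap
    { toFun := offCorner, map_add' := fun _ _ => rfl, map_smul' := fun _ _ => rfl }

theorem HasFamily.image_offCorner_mem_nhds {r : ℕ} {B : Matrix (κ ⊕ Unit) (κ ⊕ Unit) ℂ}
    {v u : κ ⊕ Unit → ℂ} (hv : v (.inr ()) = 1) (hu : u (.inr ()) = 1)
    (h : HasFamily r B fun Z => ∃ c : ℂ, Z = c • Matrix.vecMulVec v u) :
    offCorner '' skewProducts (κ ⊕ Unit) r ∈ 𝓝 (offCorner B) := by
  obtain ⟨E, i1, i2, i3, F, F', x, rfl, h2, h3, h4⟩ := h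
  have hd : HasStrictFDerivAt (fun y => offCorner (F y)) (offCornerL.comp F') x :=
    offCornerL.hasStrictFDerivAt.comp x h3
  have hrange : (offCornerL.comp F').range = ⊤ := by
    by_contra hne
    obtain ⟨φ, hφ, hle⟩ := Submodule.exists_le_ker_of_lt_top _ (lt_top_iff_ne_top.mpr hne)
    classical
    let Z : Matrix (κ ⊕ Unit) (κ ⊕ Unit) ℂ := fun j i =>
      if hp : (i, j) ≠ (.inr (), .inr ()) then φ (Pi.single ⟨(i, j), hp⟩ 1) else 0
    have htr : ∀ M, (Z * M).trace = φ (offCorner M) := by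
      intro M
      rw [← Finset.univ_sum_single (offCorner M), map_sum, Matrix.trace_mul_comm]
      have : ∀ p, φ (Pi.single p (offCorner M p)) = M p.1.1 p.1.2 * Z p.1.2 p.1.1 := by
        rintro ⟨⟨i, j⟩, hp⟩
        have : (Pi.single ⟨(i, j), hp⟩ (offCorner M ⟨(i, j), hp⟩) : OffCorner κ → ℂ) =
            M i j • (Pi.single ⟨(i, j), hp⟩ (1 : ℂ) : OffCorner κ → ℂ) := by
          rw [← Pi.single_smul]
          simp [offCorner]
        rw [this, map_smul]
        simp only [Z, dif_pos hp, smul_eq_mul]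
      rw [Finset.sum_congr rfl fun p _ => this p,
        ← Finset.sum_subtype (Finset.univ.filter (· ≠ (Sum.inr (), Sum.inr ()))) (by simp)
          (fun p : (κ ⊕ Unit) × (κ ⊕ Unit) => M p.1 p.2 * Z p.2 p.1),
        Finset.sum_filter_of_ne, Fintype.sum_prod_type]
      · rfl
      · rintro p - hp rfl
        simp [Z] at hp
    obtain ⟨c, hc⟩ := h4 Z fun dx => by
      rw [htr]
      exact hle ⟨dx, rfl⟩
    have hc0 : c = 0 := by
      have := congrFun (congrFun hc (.inr ())) (.inr ())
      simpa [Z, Matrix.vecMulVec_apply, hv, hu] using this.symm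
    refine hφ (LinearMap.pi_ext' fun p => LinearMap.ext_ring ?_)
    have := congrFun (congrFun hc p.1.2) p.1.1
    simp only [Z, dif_pos p.2, hc0, zero_smul] at this
    simpa using this
  have := hd.map_nhds_eq_of_surj hrange
  rw [← this, Filter.mem_map]
  exact Filter.univ_mem' fun y => ⟨F y, h2 y, rfl⟩

/-- The `i`-th generic skew symmetric matrix. -/
noncomputable def genericSkew (ι : Type) {r : ℕ} (i : Fin r) :
    Matrix ι ι (MvPolynomial (Fin r × ι × ι) ℂ) :=
  Matrix.of fun a b => MvPolynomial.X (i, a, b) - MvPolynomial.X (i, b, a)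

theorem map_prod_genericSkew {r : ℕ} (x : Fin r × ι × ι → ℂ) :
    (MvPolynomial.eval x).mapMatrix (List.ofFn (genericSkew ι (r := r))).prod =
      (List.ofFn fun i => Matrix.of fun a b => x (i, a, b) - x (i, b, a)).prod := by
  rw [map_list_prod, List.map_ofFn]
  congr 2
  ext i a b
  simp [genericSkew]

theorem map_prod_genericSkew_mem {r : ℕ} (x : Fin r × ι × ι → ℂ) :
    (MvPolynomial.eval x).mapMatrix (List.ofFn (genericSkew ι (r := r))).prod ∈
      skewProducts ι r :=
  ⟨_, fun i => by ext a b; simp, map_prod_genericSkew x⟩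

theorem exists_map_prod_genericSkew {r : ℕ} {A : Matrix ι ι ℂ} (hA : A ∈ skewProducts ι r) :
    ∃ x, (MvPolynomial.eval x).mapMatrix (List.ofFn (genericSkew ι (r := r))).prod = A := by
  obtain ⟨f, hf, rfl⟩ := hA
  refine ⟨fun p => f p.1 p.2.1 p.2.2 / 2, ?_⟩
  rw [map_prod_genericSkew]
  congr 2
  ext i a b
  have : f i b a = - f i a b := congrFun (congrFun (hf i) a) b
  simp only [Matrix.of_apply, this]
  ring

theorem det_eq_zero_of_mem_skewProducts {r : ℕ} (hι : Odd (Fintype.card ι)) (hr : 0 < r)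
    {A : Matrix ι ι ℂ} (hA : A ∈ skewProducts ι r) : A.det = 0 := by
  obtain ⟨f, hf, rfl⟩ := hA
  obtain ⟨k, rfl⟩ := Nat.exists_eq_succ_of_ne_zero hr.ne'
  have h0 : (f 0).det = 0 := by
    have := congrArg Matrix.det (hf 0)
    rw [Matrix.det_transpose, Matrix.det_neg, hι.neg_one_pow] at this
    linear_combination this / 2
  simp [List.ofFn_succ, h0]

/-- The property asserted in the main theorem, for matrices indexed by an arbitrary type: a
generic singular matrix is a product of `r` skew symmetric ones. -/
def GenericallySkewProduct (ι : Type) [Fintype ι] [DecidableEq ι] (r : ℕ) : Prop :=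
  ∃ P : MvPolynomial (ι × ι) ℂ,
    (∃ A : Matrix ι ι ℂ, A.det = 0 ∧ MvPolynomial.eval (fun p => A p.1 p.2) P ≠ 0) ∧
    ∀ A : Matrix ι ι ℂ, A.det = 0 → MvPolynomial.eval (fun p => A p.1 p.2) P ≠ 0 →
      A ∈ skewProducts ι r

theorem HasFamily.genericallySkewProduct {r : ℕ} (hκ : Even (Fintype.card κ)) (hr : 0 < r)
    {B : Matrix (κ ⊕ Unit) (κ ⊕ Unit) ℂ}
    {v u : κ ⊕ Unit → ℂ} (hv : v (.inr ()) = 1) (hu : u (.inr ()) = 1)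
    (h : HasFamily r B fun Z => ∃ c : ℂ, Z = c • Matrix.vecMulVec v u) :
    GenericallySkewProduct (κ ⊕ Unit) r := by
  have hodd : Odd (Fintype.card (κ ⊕ Unit)) := by simpa using hκ.add_one
  let f : OffCorner κ → MvPolynomial (Fin r × (κ ⊕ Unit) × (κ ⊕ Unit)) ℂ := fun p =>
    (List.ofFn (genericSkew (κ ⊕ Unit) (r := r))).prod p.1.1 p.1.2
  have hf : AlgebraicIndependent ℂ f := by
    refine algebraicIndependent_of_range_mem_nhds (y := offCorner B)
      (Filter.mem_of_superset (h.image_offCorner_mem_nhds hv hu) ?_)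
    rintro _ ⟨A, hA, rfl⟩
    obtain ⟨x, rfl⟩ := exists_map_prod_genericSkew hA
    exact ⟨x, rfl⟩
  obtain ⟨Q, hQ0, hQ⟩ := hf.exists_forall_eval_ne_zero
  let e : κ × κ → OffCorner κ := fun p => ⟨(.inl p.1, .inl p.2), by simp⟩
  have he : Function.Injective e := by
    rintro ⟨a, b⟩ ⟨c, d⟩ h
    simpa [e] using congrArg Subtype.val h
  let D : MvPolynomial (OffCorner κ) ℂ := MvPolynomial.rename e (Matrix.mvPolynomialX κ κ ℂ).det
  have hD0 : D ≠ 0 := by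
    rw [Ne, map_eq_zero_iff _ (MvPolynomial.rename_injective e he)]
    exact Matrix.det_mvPolynomialX_ne_zero κ ℂ
  have hD : ∀ A : Matrix (κ ⊕ Unit) (κ ⊕ Unit) ℂ,
      MvPolynomial.eval (offCorner A) D = A.toBlocks₁₁.det := by
    intro A
    rw [MvPolynomial.eval_rename, RingHom.map_det]
    congr 1
    ext i j
    simp [offCorner, e, Matrix.toBlocks₁₁]
  have hcorner : ∀ A A' : Matrix (κ ⊕ Unit) (κ ⊕ Unit) ℂ, offCorner A = offCorner A' →
      A.toBlocks₁₁.det ≠ 0 → A.det = 0 → A'.det = 0 → A = A' := by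
    intro A A' h hdet hA hA'
    have hij : ∀ i j, (i, j) ≠ (Sum.inr (), Sum.inr ()) → A i j = A' i j :=
      fun i j hp => congrFun h ⟨(i, j), hp⟩
    have h11 : A.toBlocks₁₁ = A'.toBlocks₁₁ := by ext; exact hij _ _ (by simp)
    have h12 : A.toBlocks₁₂ = A'.toBlocks₁₂ := by ext; exact hij _ _ (by simp)
    have h21 : A.toBlocks₂₁ = A'.toBlocks₂₁ := by ext; exact hij _ _ (by simp)
    let _ : Invertible A.toBlocks₁₁ := Matrix.invertibleOfIsUnitDet _ (isUnit_iff_ne_zero.mpr hdet)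
    rw [← A.fromBlocks_toBlocks, Matrix.det_fromBlocks₁₁, mul_eq_zero, or_iff_right hdet,
      Matrix.det_unique, Matrix.sub_apply, sub_eq_zero] at hA
    rw [← A'.fromBlocks_toBlocks, ← h11, ← h12, ← h21, Matrix.det_fromBlocks₁₁, mul_eq_zero,
      or_iff_right hdet, Matrix.det_unique, Matrix.sub_apply, sub_eq_zero, ← hA] at hA'
    ext i j
    by_cases hp : (i, j) = (Sum.inr (), Sum.inr ())
    · rw [Prod.mk.injEq] at hp
      rw [hp.1, hp.2]
      exact hA'.symm
    · exact hij i j hp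
  refine ⟨MvPolynomial.rename Subtype.val (Q * D), ?_, fun A hA hP => ?_⟩
  · obtain ⟨y, hy⟩ : ∃ y, MvPolynomial.eval y (Q * D) ≠ 0 := by
      by_contra! hcon
      exact mul_ne_zero hQ0 hD0 (MvPolynomial.funext fun y => by simpa using hcon y)
    rw [map_mul] at hy
    obtain ⟨x, hx⟩ := hQ y (left_ne_zero_of_mul hy)
    refine ⟨_, det_eq_zero_of_mem_skewProducts hodd hr (map_prod_genericSkew_mem x), ?_⟩
    rw [MvPolynomial.eval_rename, map_mul]
    convert hy <;> exact funext hx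
  · rw [MvPolynomial.eval_rename, map_mul] at hP
    obtain ⟨x, hx⟩ := hQ _ (left_ne_zero_of_mul hP)
    have hmem := map_prod_genericSkew_mem x
    have hx' : offCorner A = offCorner ((MvPolynomial.eval x).mapMatrix
      (List.ofFn (genericSkew (κ ⊕ Unit) (r := r))).prod) := (funext hx).symm
    rw [hcorner A _ hx' ?_ hA
      (det_eq_zero_of_mem_skewProducts hodd hr hmem)]
    · exact hmem
    · rw [← hD]
      exact right_ne_zero_of_mul hP

/-- A point at which the family of products of `r` skew symmetric matrices is as transverse as
possible: the only obstruction is the pair of kernel vectors `u`, `v` of the product. -/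
structure IsRegularPoint (r : ℕ) (B : Matrix ι ι ℂ) (v u : ι → ℂ) : Prop where
  hasFamily : HasFamily r B fun Z => ∃ c : ℂ, Z = c • Matrix.vecMulVec v u
  vecMul_eq_zero : u ᵥ* B = 0
  eq_smul : ∀ z, B *ᵥ z = 0 → ∃ c : ℂ, z = c • v

theorem IsRegularPoint.mul {r : ℕ} {B S : Matrix ι ι ℂ} {v u : ι → ℂ}
    (h : IsRegularPoint r B v u) (hu : u ⬝ᵥ u ≠ 0) (hS : Sᵀ = -S) (hSu : S *ᵥ u = 0)
    (hker : ∀ z, S *ᵥ z = 0 → ∃ c : ℂ, z = c • u) : IsRegularPoint (r + 1) (S * B) v u := by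
  have hinj : ∀ z, (∃ c : ℂ, B *ᵥ z = c • u) → B *ᵥ z = 0 := by
    rintro z ⟨c, hc⟩
    have h1 : u ⬝ᵥ (B *ᵥ z) = 0 := by
      rw [Matrix.dotProduct_mulVec, h.vecMul_eq_zero, zero_dotProduct]
    rw [hc, dotProduct_smul, smul_eq_mul, mul_eq_zero, or_iff_left hu] at h1
    rw [hc, h1, zero_smul]
  have huS : u ᵥ* S = 0 := by
    rw [← Matrix.mulVec_transpose, hS, Matrix.neg_mulVec, hSu, neg_zero]
  refine ⟨(h.hasFamily.mul hS).mono ?_, ?_, fun z hz => ?_⟩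
  · rintro Z ⟨⟨c, hc⟩, hsymm⟩
    have hZS : Z * S = 0 := by
      have h1 : (Z * S) *ᵥ u = 0 := by rw [← Matrix.mulVec_mulVec, hSu, Matrix.mulVec_zero]
      rw [hc, Matrix.smul_mulVec, Matrix.vecMulVec_mulVec] at h1
      have h2 : c • v = 0 := by
        ext i
        have := congrFun h1 i
        simpa [hu] using this
      rw [hc, ← Matrix.smul_vecMulVec, h2, Matrix.zero_vecMulVec]
    have hrow : ∀ i, ∃ c : ℂ, Z i = c • u := fun i => hker _ <| by
      have : S *ᵥ Z i = -(Z i ᵥ* S) := by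
        rw [← Matrix.mulVec_transpose, hS, Matrix.neg_mulVec, neg_neg]
      rw [this, neg_eq_zero]
      exact congrFun hZS i
    choose z hz using hrow
    have hZ : Z = Matrix.vecMulVec z u := by
      ext i j
      simp [hz i, Matrix.vecMulVec_apply]
    have hBz : B *ᵥ z = 0 := by
      refine hinj z ⟨(B *ᵥ z ⬝ᵥ u) / (u ⬝ᵥ u), ?_⟩
      have h1 := congrArg (fun M => M *ᵥ u) hsymm.eq
      simp only [hZ, Matrix.mul_vecMulVec, Matrix.transpose_vecMulVec,
        Matrix.vecMulVec_mulVec] at h1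
      ext i
      have := congrFun h1 i
      simp only [Pi.smul_apply, MulOpposite.smul_eq_mul_unop, MulOpposite.unop_op,
        smul_eq_mul] at this ⊢
      field_simp
      linear_combination -this
    obtain ⟨c, rfl⟩ := h.eq_smul z hBz
    exact ⟨c, by rw [hZ, Matrix.smul_vecMulVec]⟩
  · rw [← Matrix.vecMul_vecMul, huS, Matrix.zero_vecMul]
  · rw [← Matrix.mulVec_mulVec] at hz
    exact h.eq_smul z (hinj z (hker _ hz))

/-- Extension of a matrix by a zero row and a zero column. -/
def border (J : Matrix κ κ ℂ) : Matrix (κ ⊕ Unit) (κ ⊕ Unit) ℂ := Matrix.fromBlocks J 0 0 0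

theorem transpose_border {α : Type} {J : Matrix α α ℂ} (hJ : Jᵀ = -J) :
    (border J)ᵀ = -border J := by
  simp [border, Matrix.fromBlocks_transpose, Matrix.fromBlocks_neg, hJ]

theorem IsRegularPoint.border_mul {r : ℕ} {B : Matrix (κ ⊕ Unit) (κ ⊕ Unit) ℂ}
    {v : κ ⊕ Unit → ℂ} (h : IsRegularPoint r B v (Pi.single (.inr ()) 1)) {J J' : Matrix κ κ ℂ}
    (hJ : Jᵀ = -J) (hJ' : J' * J = 1) :
    IsRegularPoint (r + 1) (border J * B) v (Pi.single (.inr ()) 1) := by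
  refine h.mul (by simp) (transpose_border hJ) ?_ fun z hz => ?_
  · ext i
    rcases i with i | i <;> simp [border]
  · rw [border, Matrix.fromBlocks_mulVec] at hz
    have h1 : J *ᵥ (z ∘ Sum.inl) = 0 := by
      ext i
      simpa using congrFun hz (.inl i)
    have h2 : z ∘ Sum.inl = 0 := by
      rw [← Matrix.one_mulVec (z ∘ Sum.inl), ← hJ', ← Matrix.mulVec_mulVec, h1,
        Matrix.mulVec_zero]
    refine ⟨z (.inr ()), ?_⟩
    ext i
    rcases i with i | i
    · simpa using congrFun h2 i
    · simp

theorem IsRegularPoint.exists_add {r : ℕ} {B : Matrix (κ ⊕ Unit) (κ ⊕ Unit) ℂ}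
    {v : κ ⊕ Unit → ℂ} (h : IsRegularPoint r B v (Pi.single (.inr ()) 1)) {J J' : Matrix κ κ ℂ}
    (hJ : Jᵀ = -J) (hJ' : J' * J = 1) (k : ℕ) :
    ∃ B, IsRegularPoint (r + k) B v (Pi.single (.inr ()) 1) := by
  induction k with
  | zero => exact ⟨B, h⟩
  | succ k ih =>
    obtain ⟨B', hB'⟩ := ih
    exact ⟨_, hB'.border_mul hJ hJ'⟩

theorem GenericallySkewProduct.congr {r : ℕ} (e : ι ≃ κ) (h : GenericallySkewProduct ι r) :
    GenericallySkewProduct κ r := by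
  obtain ⟨P, ⟨A, hA, hPA⟩, hP⟩ := h
  have heval : ∀ A : Matrix κ κ ℂ, MvPolynomial.eval (fun p => A p.1 p.2)
      (MvPolynomial.rename (e.prodCongr e) P) =
      MvPolynomial.eval (fun p => A.submatrix e e p.1 p.2) P := by
    intro A
    rw [MvPolynomial.eval_rename]
    rfl
  refine ⟨MvPolynomial.rename (e.prodCongr e) P, ⟨A.submatrix e.symm e.symm, ?_, ?_⟩, ?_⟩
  · rw [Matrix.det_submatrix_equiv_self, hA]
  · rw [heval]
    simpa using hPA
  · intro M hM hPM
    rw [heval] at hPM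
    obtain ⟨f, hf, hprod⟩ := hP (M.submatrix e e) (by rw [Matrix.det_submatrix_equiv_self, hM]) hPM
    refine ⟨fun i => (f i).submatrix e.symm e.symm, fun i => ?_, ?_⟩
    · rw [Matrix.transpose_submatrix, hf, Matrix.submatrix_neg]
      rfl
    · have h1 := congrArg (Matrix.reindexAlgEquiv ℂ ℂ e) hprod
      rw [map_list_prod, List.map_ofFn] at h1
      rw [← show Matrix.reindexAlgEquiv ℂ ℂ e (M.submatrix e e) = M by ext; simp, h1]
      rfl

end Families

section OrderThree

/-- A `3 × 3` matrix given by its rows. -/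
def ofRows (a b c d e f g h i : ℂ) : Matrix ((Unit ⊕ Unit) ⊕ Unit) ((Unit ⊕ Unit) ⊕ Unit) ℂ
  | .inl (.inl _), .inl (.inl _) => a
  | .inl (.inl _), .inl (.inr _) => b
  | .inl (.inl _), .inr _ => c
  | .inl (.inr _), .inl (.inl _) => d
  | .inl (.inr _), .inl (.inr _) => e
  | .inl (.inr _), .inr _ => f
  | .inr _, .inl (.inl _) => g
  | .inr _, .inl (.inr _) => h
  | .inr _, .inr _ => i

theorem exists_eq_ofRows (Z : Matrix ((Unit ⊕ Unit) ⊕ Unit) ((Unit ⊕ Unit) ⊕ Unit) ℂ) :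
    ∃ a b c d e f g h i, Z = ofRows a b c d e f g h i := by
  refine ⟨Z (.inl (.inl ())) (.inl (.inl ())), Z (.inl (.inl ())) (.inl (.inr ())),
    Z (.inl (.inl ())) (.inr ()), Z (.inl (.inr ())) (.inl (.inl ())),
    Z (.inl (.inr ())) (.inl (.inr ())), Z (.inl (.inr ())) (.inr ()),
    Z (.inr ()) (.inl (.inl ())), Z (.inr ()) (.inl (.inr ())), Z (.inr ()) (.inr ()), ?_⟩
  ext ((i | i) | i) ((j | j) | j) <;> rfl

theorem ofRows_mul (a b c d e f g h i a' b' c' d' e' f' g' h' i' : ℂ) :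
    ofRows a b c d e f g h i * ofRows a' b' c' d' e' f' g' h' i' =
      ofRows (a * a' + b * d' + c * g') (a * b' + b * e' + c * h') (a * c' + b * f' + c * i')
        (d * a' + e * d' + f * g') (d * b' + e * e' + f * h') (d * c' + e * f' + f * i')
        (g * a' + h * d' + i * g') (g * b' + h * e' + i * h') (g * c' + h * f' + i * i') := by
  ext ((i | i) | i) ((j | j) | j) <;> simp [ofRows, Matrix.mul_apply, Fintype.sum_sum_type]

theorem transpose_ofRows (a b c d e f g h i : ℂ) :
    (ofRows a b c d e f g h i)ᵀ = ofRows a d g b e h c f i := by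
  ext ((i | i) | i) ((j | j) | j) <;> rfl

theorem neg_ofRows (a b c d e f g h i : ℂ) :
    -ofRows a b c d e f g h i = ofRows (-a) (-b) (-c) (-d) (-e) (-f) (-g) (-h) (-i) := by
  ext ((i | i) | i) ((j | j) | j) <;> rfl

theorem isSymm_ofRows {a b c d e f g h i : ℂ} (hs : (ofRows a b c d e f g h i).IsSymm) :
    d = b ∧ g = c ∧ h = f :=
  ⟨hs.apply (.inl (.inl ())) (.inl (.inr ())), hs.apply (.inl (.inl ())) (.inr ()),
    hs.apply (.inl (.inr ())) (.inr ())⟩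

theorem exists_isRegularPoint_four :
    ∃ B : Matrix ((Unit ⊕ Unit) ⊕ Unit) ((Unit ⊕ Unit) ⊕ Unit) ℂ,
    IsRegularPoint 4 B (Pi.single (.inr ()) 1) (Pi.single (.inr ()) 1) := by
  have hJ : (ofRows 0 (-1) 0 1 0 0 0 0 0)ᵀ = -ofRows 0 (-1) 0 1 0 0 0 0 0 := by
    simp [transpose_ofRows, neg_ofRows]
  have hT : (ofRows 0 (-1) 0 1 0 (-1) 0 1 0)ᵀ = -ofRows 0 (-1) 0 1 0 (-1) 0 1 0 := by
    simp [transpose_ofRows, neg_ofRows]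
  refine ⟨_, (((hasFamily_one.mul hJ).mul hT).mul hT).mul hJ |>.mono ?_, ?_, ?_⟩
  · rintro Z ⟨⟨⟨⟨-, h1⟩, h2⟩, h3⟩, h4⟩
    obtain ⟨a, b, c, d, e, f, g, h, i, rfl⟩ := exists_eq_ofRows Z
    simp only [mul_one, one_mul, ofRows_mul] at h1 h2 h3 h4
    replace h1 := isSymm_ofRows h1
    replace h2 := isSymm_ofRows h2
    replace h3 := isSymm_ofRows h3
    replace h4 := isSymm_ofRows h4
    simp only [mul_zero, zero_mul, mul_neg, mul_one, add_zero, zero_add, neg_zero, one_mul, neg_neg,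
      neg_mul] at h1 h2 h3 h4
    obtain ⟨h11, h12, h13⟩ := h1
    obtain ⟨h21, h22, h23⟩ := h2
    obtain ⟨-, rfl, -⟩ := h3
    obtain ⟨h41, h42, h43⟩ := h4
    have ha : a = 0 := h23.symm
    have hd : d = 0 := by linear_combination h22
    have he : e = 0 := by linear_combination -h21 - ha
    have hc : c = 0 := by linear_combination h43 / 2 + he / 2
    have hf : f = 0 := by linear_combination -h42 - hd
    have hg : g = 0 := by linear_combination h13 / 2 + he / 2
    have hh : h = 0 := by linear_combination -h12
    refine ⟨i, ?_⟩
    rw [ha, hc, hd, he, hf, hg, hh]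
    ext ((i | i) | i) ((j | j) | j) <;> simp [ofRows, Matrix.vecMulVec_apply]
  · simp only [mul_one, ofRows_mul]
    ext ((i | i) | i) <;> simp [ofRows]
  · intro z hz
    simp only [mul_one, ofRows_mul] at hz
    have h0 := congrFun hz (.inl (.inl ()))
    have h1 := congrFun hz (.inl (.inr ()))
    simp [ofRows, Matrix.mulVec, dotProduct, Fintype.sum_sum_type] at h0 h1
    refine ⟨z (.inr ()), ?_⟩
    ext ((i | i) | i) <;> simp [h0, h1]

end OrderThree

section General

variable {m : ℕ}

/-- A skew symmetric matrix all of whose off-diagonal entries are nonzero. -/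
def signs (m : ℕ) : Matrix (Fin m) (Fin m) ℂ :=
  Matrix.of fun i j => if i < j then 1 else if j < i then -1 else 0

theorem transpose_signs : (signs m)ᵀ = -signs m := by
  ext i j
  rcases lt_trichotomy i j with h | h | h <;> simp [signs, h, h.not_gt]

/-- A skew symmetric matrix with pairwise distinct parameters. -/
noncomputable def weighted (m : ℕ) : Matrix (Fin m ⊕ Fin m) (Fin m ⊕ Fin m) ℂ :=
  Matrix.fromBlocks 0 (Matrix.diagonal fun i : Fin m => (i : ℂ) + 1)
    (-Matrix.diagonal fun i : Fin m => (i : ℂ) + 1) 0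

/-- The inverse of `weighted m`. -/
noncomputable def weightedInv (m : ℕ) : Matrix (Fin m ⊕ Fin m) (Fin m ⊕ Fin m) ℂ :=
  Matrix.fromBlocks 0 (-Matrix.diagonal fun i : Fin m => ((i : ℂ) + 1)⁻¹)
    (Matrix.diagonal fun i : Fin m => ((i : ℂ) + 1)⁻¹) 0

/-- The negative of the symplectic matrix, perturbed by `signs m`. -/
def twisted (m : ℕ) : Matrix (Fin m ⊕ Fin m) (Fin m ⊕ Fin m) ℂ :=
  Matrix.fromBlocks 0 1 (-1) (signs m)

/-- The inverse of `twisted m`. -/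
def twistedInv (m : ℕ) : Matrix (Fin m ⊕ Fin m) (Fin m ⊕ Fin m) ℂ :=
  Matrix.fromBlocks (signs m) (-1) 1 0

theorem transpose_weighted : (weighted m)ᵀ = -weighted m := by
  simp [weighted, Matrix.fromBlocks_transpose, Matrix.fromBlocks_neg]

theorem transpose_twisted : (twisted m)ᵀ = -twisted m := by
  simp [twisted, Matrix.fromBlocks_transpose, Matrix.fromBlocks_neg, transpose_signs]

theorem neg_J_mul_J {α : Type} [Fintype α] [DecidableEq α] :
    -Matrix.J α ℂ * Matrix.J α ℂ = 1 := by
  rw [neg_mul, Matrix.J_squared, neg_neg]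

theorem weightedInv_mul : weightedInv m * weighted m = 1 := by
  have : ∀ i : Fin m, ((i : ℂ) + 1)⁻¹ * ((i : ℂ) + 1) = 1 := fun i =>
    inv_mul_cancel₀ (Nat.cast_add_one_ne_zero _)
  simp [weightedInv, weighted, Matrix.fromBlocks_multiply, this, -neg_add_rev]

theorem twistedInv_mul : twistedInv m * twisted m = 1 := by
  simp [twistedInv, twisted, Matrix.fromBlocks_multiply]

theorem isSymm_conj {ι : Type} [Fintype ι] {M : Matrix ι ι ℂ} (h : M.IsSymm)
    (A : Matrix ι ι ℂ) : (Aᵀ * M * A).IsSymm := by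
  rw [Matrix.IsSymm, Matrix.transpose_mul, Matrix.transpose_mul, h.eq, Matrix.transpose_transpose,
    mul_assoc]

theorem eq_zero_of_isSymm_products (hm : 2 ≤ m) {Z : Matrix (Fin m ⊕ Fin m) (Fin m ⊕ Fin m) ℂ}
    (h1 : (Z * weighted m * Matrix.J (Fin m) ℂ).IsSymm) (h2 : (twisted m * Z * weighted m).IsSymm)
    (h3 : (Matrix.J (Fin m) ℂ * twisted m * Z).IsSymm)
    (hv : Sum.elim 0 1 ᵥ* (twisted m * Z * weighted m) = 0) : Z = 0 := by
  set Y := twisted m * Z * weighted m with hY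
  have h3' : (weighted m * Matrix.J (Fin m) ℂ * Y).IsSymm := by
    have := isSymm_conj h3 (weighted m)
    rw [transpose_weighted] at this
    convert this.neg using 1
    rw [hY]
    noncomm_ring
  have h1' : (Y * Matrix.J (Fin m) ℂ * twisted m).IsSymm := by
    have := isSymm_conj h1 (twisted m)ᵀ
    rw [Matrix.transpose_transpose, transpose_twisted] at this
    convert this.neg using 1
    rw [hY]
    noncomm_ring
  have hY0 : Y = 0 := by
    clear_value Y
    clear hY h1 h3
    obtain ⟨a, b, c, d, rfl⟩ : ∃ a b c d, Y = Matrix.fromBlocks a b c d :=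
      ⟨_, _, _, _, Y.fromBlocks_toBlocks.symm⟩
    rw [Matrix.isSymm_fromBlocks_iff] at h2
    obtain ⟨ha, hb, -, hd⟩ := h2
    simp only [weighted, Matrix.J, Matrix.fromBlocks_multiply, Matrix.isSymm_fromBlocks_iff,
      mul_zero, zero_mul, add_zero, zero_add, mul_one, mul_neg, neg_neg, neg_zero] at h3'
    simp only [twisted, Matrix.J, Matrix.fromBlocks_multiply, Matrix.isSymm_fromBlocks_iff,
      mul_zero, add_zero, zero_add, mul_one, mul_neg, neg_mul, neg_neg] at h1'
    obtain ⟨ha', hb', -, hd'⟩ := h3'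
    have hw : ∀ {i j : Fin m} {x : ℂ}, i ≠ j → ((i : ℂ) + 1) * x = ((j : ℂ) + 1) * x → x = 0 := by
      intro i j x hij hx
      refine (mul_eq_mul_right_iff.mp hx).resolve_left fun h => hij (Fin.ext ?_)
      exact_mod_cast add_right_cancel h
    have ha0 : ∀ i j, i ≠ j → a i j = 0 := fun i j hij => hw hij <| by
      have := ha'.apply j i
      simp only [Matrix.diagonal_mul] at this
      rw [this, ha.apply]
    have hd0 : ∀ i j, i ≠ j → d i j = 0 := fun i j hij => hw hij <| by
      have := hd'.apply j i
      simp only [Matrix.diagonal_mul] at this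
      rw [this, hd.apply]
    have hc0 : ∀ i j, i ≠ j → c i j = 0 := fun i j hij => hw hij <| by
      have := congrFun (congrFun hb' i) j
      simp only [Matrix.transpose_apply, Matrix.diagonal_mul] at this
      rw [← this, ← hb, Matrix.transpose_apply]
    have hc1 : c = 0 := by
      ext i j
      by_cases hij : i = j
      · subst hij
        have := congrFun hv (.inl i)
        simpa [Matrix.vecMul, dotProduct, Fintype.sum_sum_type,
          Finset.sum_eq_single i (fun k _ hk => hc0 k i hk)] using this
      · exact hc0 i j hij
    have hd1 : d = 0 := by
      ext i j
      by_cases hij : i = j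
      · subst hij
        have := congrFun hv (.inr i)
        simpa [Matrix.vecMul, dotProduct, Fintype.sum_sum_type,
          Finset.sum_eq_single i (fun k _ hk => hd0 k i hk)] using this
      · exact hd0 i j hij
    have hb1 : b = 0 := by rw [← Matrix.transpose_transpose b, hb, hc1, Matrix.transpose_zero]
    have ha1 : a = 0 := by
      have haC : a * signs m = 0 := by
        have := h1'.2.2.1
        simpa [hb1, hc1] using this.symm
      ext i j
      by_cases hij : i = j
      · subst hij
        have : Nontrivial (Fin m) := Fin.nontrivial_iff_two_le.mpr hm
        obtain ⟨k, hk⟩ := exists_ne i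
        have h := congrFun (congrFun haC i) k
        rw [Matrix.mul_apply, Finset.sum_eq_single i
          (fun l _ hl => by rw [ha0 i l hl.symm, zero_mul]) (by simp)] at h
        refine (mul_eq_zero.mp h).resolve_right ?_
        rcases lt_or_gt_of_ne hk with h | h <;> simp [signs, h, h.not_gt]
      · exact ha0 i j hij
    rw [ha1, hb1, hc1, hd1, Matrix.fromBlocks_zero]
  calc Z = twistedInv m * Y * weightedInv m := by
        rw [hY, mul_assoc, mul_assoc _ (weighted m), mul_eq_one_comm.mp weightedInv_mul, mul_one,
          ← mul_assoc, twistedInv_mul, one_mul]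
    _ = 0 := by rw [hY0, mul_zero, zero_mul]


theorem exists_isRegularPoint_of_isSymm {κ : Type} [Fintype κ] [DecidableEq κ]
    {J₁ J₂ J₃ J₁' J₂' J₃' : Matrix κ κ ℂ} {v : κ → ℂ}
    (hJ₁ : J₁ᵀ = -J₁) (hJ₂ : J₂ᵀ = -J₂) (hJ₃ : J₃ᵀ = -J₃)
    (hJ₁' : J₁' * J₁ = 1) (hJ₂' : J₂' * J₂ = 1) (hJ₃' : J₃' * J₃ = 1)
    (h : ∀ Z : Matrix κ κ ℂ, (Z * J₁ * J₂).IsSymm → (J₃ * Z * J₁).IsSymm → (J₂ * J₃ * Z).IsSymm →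
      v ᵥ* (J₃ * Z * J₁) = 0 → Z = 0) :
    ∃ B, IsRegularPoint 3 B (Sum.elim v 1) (Pi.single (.inr ()) 1) := by
  set V := Matrix.replicateCol Unit v with hV
  have hcancel : ∀ {x y : Matrix κ Unit ℂ}, J₂ * J₃ * x = J₂ * J₃ * y → x = y := by
    intro x y hxy
    have := congrArg (fun M => J₃' * (J₂' * M)) hxy
    simpa only [← mul_assoc, ← Matrix.mul_assoc, mul_assoc J₃', hJ₂', mul_one, hJ₃',
      Matrix.one_mul] using this
  have hS₃ : (Matrix.fromBlocks J₃ (-(J₃ * V)) (-(Vᵀ * J₃)) (Vᵀ * J₃ * V))ᵀ =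
      -Matrix.fromBlocks J₃ (-(J₃ * V)) (-(Vᵀ * J₃)) (Vᵀ * J₃ * V) := by
    simp [Matrix.fromBlocks_transpose, Matrix.fromBlocks_neg, hJ₃, Matrix.mul_assoc]
  refine ⟨_, ((hasFamily_one.mul hS₃).mul (transpose_border hJ₂)).mul
    (transpose_border hJ₁) |>.mono ?_, ?_, ?_⟩
  · rintro Z ⟨⟨⟨-, h1⟩, h2⟩, h3⟩
    obtain ⟨Z, z, w, t, rfl⟩ : ∃ a b c d, Z = Matrix.fromBlocks a b c d :=
      ⟨_, _, _, _, Z.fromBlocks_toBlocks.symm⟩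
    simp only [border, mul_one, one_mul, Matrix.fromBlocks_multiply, Matrix.mul_zero,
      Matrix.zero_mul, add_zero, Matrix.isSymm_fromBlocks_iff] at h1 h2 h3
    have hw : w = 0 := by
      have h12 := congrArg (fun M => M * J₂' * J₁') h1.2.1.symm
      simpa only [Matrix.transpose_zero, Matrix.zero_mul, Matrix.mul_assoc,
        mul_eq_one_comm.mp hJ₁', mul_eq_one_comm.mp hJ₂', Matrix.mul_one,
        ← Matrix.mul_assoc J₂, Matrix.one_mul] using h12
    subst hw
    have hYv : Vᵀ * (J₃ * Z * J₁) = 0 := by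
      have := h2.2.1
      simpa [Matrix.mul_assoc] using this.symm
    have hZ : Z = 0 := by
      refine h Z (by simpa [Matrix.mul_assoc] using h1.1) (by simpa [Matrix.mul_assoc] using h2.1)
        (by simpa [Matrix.mul_assoc] using h3.1) ?_
      ext i
      simpa [hV, Matrix.mul_apply, Matrix.vecMul, dotProduct] using congrFun (congrFun hYv ()) i
    have hz : z = V * t := hcancel <| by
      have := h3.2.2.1
      simp only [Matrix.transpose_zero] at this
      rw [← sub_eq_zero]
      simpa [Matrix.mul_assoc, sub_eq_add_neg] using this.symm
    refine ⟨t () (), ?_⟩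
    rw [hZ, hz]
    ext (i | i) (j | j) <;> simp [hV, Matrix.vecMulVec_apply, Matrix.mul_apply, mul_comm]
  · simp only [border, mul_one, Matrix.fromBlocks_multiply, Matrix.zero_mul, add_zero]
    ext (i | i) <;> simp [Matrix.vecMul, dotProduct, Fintype.sum_sum_type]
  · intro z hz
    simp only [border, mul_one, Matrix.fromBlocks_multiply, Matrix.zero_mul, add_zero,
      Matrix.fromBlocks_mulVec] at hz
    have hVz : V *ᵥ (z ∘ Sum.inr) = z (.inr ()) • v := by
      ext i
      simp [hV, Matrix.mulVec, dotProduct, mul_comm]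
    have h1 : (J₁ * J₂ * J₃) *ᵥ (z ∘ Sum.inl - z (.inr ()) • v) = 0 := by
      rw [Matrix.mulVec_sub, ← hVz]
      ext i
      simpa [Matrix.mulVec_mulVec, Matrix.mul_assoc, Matrix.neg_mulVec, sub_eq_add_neg] using
        congrFun hz (.inl i)
    have hinv : J₃' * J₂' * J₁' * (J₁ * J₂ * J₃) = 1 := by
      rw [mul_assoc J₁, mul_assoc, ← mul_assoc J₁', hJ₁', one_mul, mul_assoc, ← mul_assoc J₂', hJ₂',
        one_mul, hJ₃']
    have h2 : z ∘ Sum.inl - z (.inr ()) • v = 0 := by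
      rw [← Matrix.one_mulVec (z ∘ Sum.inl - _), ← hinv, ← Matrix.mulVec_mulVec, h1,
        Matrix.mulVec_zero]
    refine ⟨z (.inr ()), ?_⟩
    ext (i | i)
    · simpa [sub_eq_zero] using congrFun h2 i
    · simp

theorem exists_isRegularPoint_three (hm : 2 ≤ m) :
    ∃ B, IsRegularPoint 3 B (Sum.elim (Sum.elim 0 1 : Fin m ⊕ Fin m → ℂ) 1)
      (Pi.single (.inr ()) 1) :=
  exists_isRegularPoint_of_isSymm transpose_weighted (Matrix.J_transpose _ _) transpose_twisted
    weightedInv_mul neg_J_mul_J twistedInv_mul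
    fun _ => eq_zero_of_isSymm_products hm

end General

end SkewProducts

/-- For odd `n` with (`n ≥ 5` and `r ≥ 3`) or (`n = 3` and `r ≥ 4`), there is
a polynomial `P` in the matrix entries, not vanishing identically on the set of matrices of
determinant zero, such that every `n×n` complex matrix `A` with `det A = 0` and `P(A) ≠ 0`
is a product of `r` skew symmetric matrices. -/
theorem stmt10 (n r : ℕ) (hn : Odd n) (hr : 0 < r)
    (hcase : (5 ≤ n ∧ 3 ≤ r) ∨ (n = 3 ∧ 4 ≤ r)) :
    ∃ P : MvPolynomial (Fin n × Fin n) ℂ,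
      (∃ A : Matrix (Fin n) (Fin n) ℂ, A.det = 0 ∧
        MvPolynomial.eval (fun p => A p.1 p.2) P ≠ 0) ∧
      (∀ A : Matrix (Fin n) (Fin n) ℂ, A.det = 0 →
        MvPolynomial.eval (fun p => A p.1 p.2) P ≠ 0 →
        ∃ f : Fin r → Matrix (Fin n) (Fin n) ℂ,
          (∀ i, (f i).transpose = -(f i)) ∧ A = (List.ofFn f).prod) := by
  suffices h : GenericallySkewProduct (Fin n) r from h
  obtain ⟨m, rfl⟩ := hn
  rcases hcase with ⟨hn, hr3⟩ | ⟨hn, hr4⟩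
  · obtain ⟨k, rfl⟩ := Nat.exists_eq_add_of_le hr3
    obtain ⟨B, hB⟩ := exists_isRegularPoint_three (m := m) (by lia)
    obtain ⟨B, hB⟩ := hB.exists_add (Matrix.J_transpose _ _) neg_J_mul_J k
    exact (hB.hasFamily.genericallySkewProduct (by simp) hr (by simp) (by simp)).congr
      (Fintype.equivFinOfCardEq (by simp [two_mul]))
  · obtain ⟨k, rfl⟩ := Nat.exists_eq_add_of_le hr4
    obtain ⟨B, hB⟩ := exists_isRegularPoint_four
    obtain ⟨B, hB⟩ := hB.exists_add (Matrix.J_transpose _ _) neg_J_mul_J k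
    exact (hB.hasFamily.genericallySkewProduct (by simp) hr (by simp) (by simp)).congr
      (Fintype.equivFinOfCardEq (by simp [hn]))
end

section
/- There exists a nonzero polynomial P in the n² matrix entries such that every n×n complex matrix A with P(A) ≠ 0 is a product of n companion matrices. -/
/-- An `n×n` matrix is a companion matrix: for every column `j < n-1`, the column is the
standard basis vector `e_{j+1}`; the last column is arbitrary. -/
def IsCompanion (n : ℕ) (C : Matrix (Fin n) (Fin n) ℂ) : Prop :=
  ∀ i j : Fin n, (j : ℕ) < n - 1 →
    C i j = if (i : ℕ) = (j : ℕ) + 1 then 1 else 0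

/-- The sequence `e_0, …, e_{n-1}, a_0, …, a_{n-1}, 0, 0, …` where `a_j` are the columns of `A`. -/
def columnSeq {R : Type*} [CommRing R] {n : ℕ} (A : Matrix (Fin n) (Fin n) R) (m : ℕ) (i : Fin n) :
    R :=
  if m < n then (if (i : ℕ) = m then 1 else 0)
  else if h : m - n < n then A i ⟨m - n, h⟩ else 0

/-- The matrix whose columns are the `n` consecutive terms of `columnSeq A` starting at `k`. -/
def columnWindow {R : Type*} [CommRing R] {n : ℕ} (A : Matrix (Fin n) (Fin n) R) (k : ℕ) :
    Matrix (Fin n) (Fin n) R :=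
  Matrix.of fun i j => columnSeq A (k + j) i

theorem columnWindow_zero {R : Type*} [CommRing R] {n : ℕ} (A : Matrix (Fin n) (Fin n) R) :
    columnWindow A 0 = 1 := by
  ext i j
  simp [columnWindow, columnSeq, Matrix.one_apply, Fin.ext_iff]

theorem columnWindow_self {R : Type*} [CommRing R] {n : ℕ} (A : Matrix (Fin n) (Fin n) R) :
    columnWindow A n = A := by
  ext i j
  simp [columnWindow, columnSeq]

theorem columnWindow_map {R S : Type*} [CommRing R] [CommRing S] (f : R →+* S) {n : ℕ}
    (A : Matrix (Fin n) (Fin n) R) (k : ℕ) :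
    f.mapMatrix (columnWindow A k) = columnWindow (f.mapMatrix A) k := by
  ext i j
  simp only [columnWindow, columnSeq, RingHom.mapMatrix_apply, Matrix.map_apply, Matrix.of_apply]
  split_ifs <;> simp

theorem det_columnWindow_one_ne_zero {n k : ℕ} (hk : k < n) :
    (columnWindow (1 : Matrix (Fin n) (Fin n) ℂ) k).det ≠ 0 := by
  let s : Fin n → Fin n := fun j => ⟨if k + j < n then k + j else k + j - n, by
    split_ifs <;> omega⟩
  have hs : Function.Injective s := by
    intro a b hab
    simp only [s, Fin.mk.injEq] at hab
    ext
    split_ifs at hab <;> omega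
  let σ : Equiv.Perm (Fin n) := Equiv.ofBijective s (Finite.injective_iff_bijective.mp hs)
  have hσ : columnWindow (1 : Matrix (Fin n) (Fin n) ℂ) k
      = (1 : Matrix (Fin n) (Fin n) ℂ).submatrix id σ := by
    ext i j
    have hj : k + (j : ℕ) - n < n := by omega
    by_cases h : k + (j : ℕ) < n <;>
      simp [columnWindow, columnSeq, σ, s, Matrix.one_apply, Fin.ext_iff, h, hj]
  rw [hσ, Matrix.det_permute']
  simp

theorem isCompanion_inv_mul_columnWindow {n : ℕ} (A : Matrix (Fin n) (Fin n) ℂ) (k : ℕ)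
    (h : IsUnit (columnWindow A k).det) :
    IsCompanion n ((columnWindow A k)⁻¹ * columnWindow A (k + 1)) := by
  intro i j hj
  have hj' : (j : ℕ) + 1 < n := by omega
  have hcol : ∀ l, columnWindow A (k + 1) l j = columnWindow A k l ⟨j + 1, hj'⟩ := by
    intro l
    simp only [columnWindow, Matrix.of_apply]
    congr 1
    omega
  have hinv := congrFun (congrFun (Matrix.nonsing_inv_mul _ h) i) ⟨j + 1, hj'⟩
  rw [Matrix.mul_apply] at hinv ⊢
  simp only [hcol, hinv, Matrix.one_apply, Fin.ext_iff]

theorem mul_prod_ofFn_inv_mul {R : Type*} [CommRing R] {n : ℕ} (M : ℕ → Matrix (Fin n) (Fin n) R)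
    (m : ℕ) (h : ∀ k < m, IsUnit (M k).det) :
    M 0 * (List.ofFn fun i : Fin m => (M i)⁻¹ * M (i + 1)).prod = M m := by
  induction m with
  | zero => simp
  | succ m ih =>
    rw [List.ofFn_succ', List.concat_eq_append, List.prod_append, ← mul_assoc]
    simp only [Fin.val_castSucc, Fin.val_last, List.prod_singleton]
    rw [ih fun k hk => h k (by omega), Matrix.mul_nonsing_inv_cancel_left _ _ (h m (by omega))]

/-- There exists a nonzero polynomial `P` in the matrix entries such that
every `n×n` complex matrix `A` with `P(A) ≠ 0` is a product of `n` companion matrices. -/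
theorem stmt14 (n : ℕ) (hn : 1 ≤ n) :
    ∃ P : MvPolynomial (Fin n × Fin n) ℂ, P ≠ 0 ∧
      ∀ A : Matrix (Fin n) (Fin n) ℂ,
        MvPolynomial.eval (fun p => A p.1 p.2) P ≠ 0 →
        ∃ f : Fin n → Matrix (Fin n) (Fin n) ℂ,
          (∀ i, IsCompanion n (f i)) ∧ A = (List.ofFn f).prod := by
  let X : Matrix (Fin n) (Fin n) (MvPolynomial (Fin n × Fin n) ℂ) :=
    Matrix.of fun i j => MvPolynomial.X (i, j)
  have heval : ∀ (A : Matrix (Fin n) (Fin n) ℂ) (k : ℕ),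
      MvPolynomial.eval (fun p => A p.1 p.2) (columnWindow X k).det = (columnWindow A k).det := by
    intro A k
    rw [RingHom.map_det, columnWindow_map]
    congr 2
    ext i j
    simp [X]
  refine ⟨∏ k ∈ Finset.range n, (columnWindow X k).det, ?_, fun A hA => ?_⟩
  · refine Finset.prod_ne_zero_iff.mpr fun k hk h0 => ?_
    apply det_columnWindow_one_ne_zero (Finset.mem_range.mp hk)
    rw [← heval, h0, map_zero]
  · rw [map_prod, Finset.prod_ne_zero_iff] at hA
    have hunit : ∀ k < n, IsUnit (columnWindow A k).det := fun k hk =>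
      isUnit_iff_ne_zero.mpr (heval A k ▸ hA k (Finset.mem_range.mpr hk))
    refine ⟨fun i => (columnWindow A i)⁻¹ * columnWindow A (i + 1),
      fun i => isCompanion_inv_mul_columnWindow A i (hunit i i.isLt), ?_⟩
    have h := mul_prod_ofFn_inv_mul (columnWindow A) n hunit
    rw [columnWindow_zero, one_mul, columnWindow_self] at h
    exact h.symm
end
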